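/- arXiv:1212.3898 — 6 statements merged into one kernel-verified Lean document; each statement's English description precedes it below -/
import Mathlib

section
/- Let G be a finite simple graph and let m, n be positive integers with m < n, and let c be a nonnegative integer. If χ(G^{m/n}) ≤ ω(G^{m/n}) + c, then χ(G^{m/(n+m+1)}) ≤ ω(G^{m/(n+m+1)}) + c. -/
open SimpleGraph

/-- Representations of vertices of the `n`-subdivision of `G`: `(u, u, 0)` represents the
branch vertex `u`, and for an adjacent pair `(u, v)`, the triple `(u, v, i)` with `i ≤ n`
represents the point at distance `i` from `u` on the path of length `n` replacing the
edge `uv`. -/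
def SubdivPre {V : Type*} (G : SimpleGraph V) (n : ℕ) : Type _ :=
  {p : V × V × ℕ // (p.1 = p.2.1 ∧ p.2.2 = 0) ∨ (G.Adj p.1 p.2.1 ∧ p.2.2 ≤ n)}

/-- The identifications between representations: `(u, v, i)` and `(v, u, n - i)` represent
the same point, and `(u, v, 0)` represents the branch vertex `u`, i.e. `(u, u, 0)`. -/
inductive SubdivRel {V : Type*} (G : SimpleGraph V) (n : ℕ) :
    SubdivPre G n → SubdivPre G n → Prop
  | flip (u v : V) (i : ℕ) (h : G.Adj u v) (hi : i ≤ n) :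
      SubdivRel G n ⟨(u, v, i), Or.inr ⟨h, hi⟩⟩
        ⟨(v, u, n - i), Or.inr ⟨h.symm, Nat.sub_le n i⟩⟩
  | collapse (u v : V) (h : G.Adj u v) :
      SubdivRel G n ⟨(u, v, 0), Or.inr ⟨h, Nat.zero_le n⟩⟩ ⟨(u, u, 0), Or.inl ⟨rfl, rfl⟩⟩

/-- The vertex set of the `n`-subdivision of `G`. -/
def SubdivVert {V : Type*} (G : SimpleGraph V) (n : ℕ) : Type _ := Quot (SubdivRel G n)

/-- The branch vertex of the subdivision corresponding to a vertex `u` of `G`. -/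
def branchVertex {V : Type*} (G : SimpleGraph V) (n : ℕ) (u : V) : SubdivVert G n :=
  Quot.mk _ ⟨(u, u, 0), Or.inl ⟨rfl, rfl⟩⟩

/-- The vertex `(uv)_i` of the subdivision: the point at distance `i` from `u` on the
path of length `n` replacing the edge `uv`. -/
def mkVert {V : Type*} (G : SimpleGraph V) (n : ℕ) {u v : V} (h : G.Adj u v)
    (i : ℕ) (hi : i ≤ n) : SubdivVert G n :=
  Quot.mk _ ⟨(u, v, i), Or.inr ⟨h, hi⟩⟩

/-- The `n`-subdivision `G^{1/n}` of `G`: each edge of `G` is replaced by a path of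
length `n`; consecutive points on such a path are adjacent. -/
def subdivision {V : Type*} (G : SimpleGraph V) (n : ℕ) : SimpleGraph (SubdivVert G n) :=
  SimpleGraph.fromRel (fun x y => ∃ (u v : V) (h : G.Adj u v) (i : ℕ) (hi : i < n),
    x = mkVert G n h i (le_of_lt hi) ∧ y = mkVert G n h (i + 1) hi)

/-- The `m`-power of a graph: two distinct vertices are adjacent iff their distance is
at most `m`, i.e. iff there is a walk of length at most `m` between them. -/
def powerGraph {W : Type*} (H : SimpleGraph W) (m : ℕ) : SimpleGraph W :=
  SimpleGraph.fromRel (fun x y => ∃ w : H.Walk x y, w.length ≤ m)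

/-- The fractional power `G^{m/n}`, the `m`-power of the `n`-subdivision of `G`. -/
def fracPower {V : Type*} (G : SimpleGraph V) (m n : ℕ) : SimpleGraph (SubdivVert G n) :=
  powerGraph (subdivision G n) m

namespace FracAux

open Classical in
/-- Total version of `mkVert`. -/
noncomputable def P {V : Type*} (G : SimpleGraph V) (n : ℕ) (u v : V) (i : ℕ) :
    SubdivVert G n :=
  if h : G.Adj u v ∧ i ≤ n then mkVert G n h.1 i h.2 else branchVertex G n u

section
variable {V : Type*} {G : SimpleGraph V} {n : ℕ}

lemma P_eq {u v : V} {i : ℕ} (h : G.Adj u v) (hi : i ≤ n) :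
    P G n u v i = mkVert G n h i hi := by
  simp [P, h, hi]

lemma P_zero (u v : V) : P G n u v 0 = branchVertex G n u := by
  by_cases h : G.Adj u v
  · rw [P_eq h (Nat.zero_le n)]
    exact Quot.sound (SubdivRel.collapse u v h)
  · simp [P, h]

lemma P_flip {u v : V} {i : ℕ} (h : G.Adj u v) (hi : i ≤ n) :
    P G n u v i = P G n v u (n - i) := by
  rw [P_eq h hi, P_eq h.symm (Nat.sub_le n i)]
  exact Quot.sound (SubdivRel.flip u v i h hi)

lemma exists_rep (x : SubdivVert G n) :
    (∃ u, x = branchVertex G n u) ∨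
      ∃ u v i, G.Adj u v ∧ 0 < i ∧ i < n ∧ x = P G n u v i := by
  induction x using Quot.ind with
  | mk p =>
    obtain ⟨⟨u, v, i⟩, h⟩ := p
    rcases h with ⟨h1, h2⟩ | ⟨h1, h2⟩
    · simp only at h1 h2
      subst h1 h2
      exact Or.inl ⟨u, rfl⟩
    · simp only at h1 h2
      have e : (Quot.mk _ ⟨(u, v, i), Or.inr ⟨h1, h2⟩⟩ : SubdivVert G n) = P G n u v i :=
        (P_eq h1 h2).symm
      rcases Nat.eq_zero_or_pos i with h0 | h0
      · left; refine ⟨u, e.trans ?_⟩; rw [h0, P_zero]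
      rcases Nat.eq_or_lt_of_le h2 with h3 | h3
      · left; refine ⟨v, e.trans ?_⟩; rw [P_flip h1 h2, h3, Nat.sub_self, P_zero]
      · right; exact ⟨u, v, i, h1, h0, h3, e⟩

open Classical in
/-- Truncated distance to the branch vertex `w`. -/
noncomputable def D (w : V) : SubdivVert G n → ℕ :=
  Quot.lift (fun p => if w = p.1.1 then p.1.2.2 else if w = p.1.2.1 then n - p.1.2.2 else n)
    (by
      intro a b hab
      cases hab with
      | flip u v i h hi =>
        have := h.ne
        simp only
        split_ifs <;> first | omega | (exfalso; simp_all)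
      | collapse u v h =>
        have := h.ne
        simp only
        split_ifs <;> first | omega | (exfalso; simp_all))

open Classical in
lemma D_P (w : V) {u v : V} {i : ℕ} (h : G.Adj u v) (hi : i ≤ n) :
    D w (P G n u v i) = if w = u then i else if w = v then n - i else n := by
  rw [P_eq h hi]; rfl

lemma P_inj (hn : 0 < n) {u v a b : V} {i p : ℕ} (h : G.Adj u v) (hi : i ≤ n)
    (h' : G.Adj a b) (hp : p ≤ n) (e : P G n u v i = P G n a b p) :
    (u = a ∧ v = b ∧ i = p) ∨ (u = b ∧ v = a ∧ i + p = n) ∨ (i = 0 ∧ p = 0 ∧ u = a) ∨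
    (i = 0 ∧ p = n ∧ u = b) ∨ (i = n ∧ p = 0 ∧ v = a) ∨ (i = n ∧ p = n ∧ v = b) := by
  have h1 := h.ne
  have h2 := h'.ne
  have eu := congrArg (D u) e
  have ev := congrArg (D v) e
  have ea := congrArg (D a) e
  have eb := congrArg (D b) e
  rw [D_P _ h hi, D_P _ h' hp] at eu ev ea eb
  grind

lemma sub_adj_rep {x y : SubdivVert G n} (h : (subdivision G n).Adj x y) :
    ∃ u v i, G.Adj u v ∧ i < n ∧ x = P G n u v i ∧ y = P G n u v (i + 1) := by
  rw [subdivision, SimpleGraph.fromRel_adj] at h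
  rcases h with ⟨-, ⟨u, v, h, i, hi, e1, e2⟩ | ⟨u, v, h, i, hi, e1, e2⟩⟩
  · exact ⟨u, v, i, h, hi, by rw [P_eq h hi.le, e1], by rw [P_eq h (Nat.succ_le_of_lt hi), e2]⟩
  · refine ⟨v, u, n - (i + 1), h.symm, by omega, ?_, ?_⟩
    · rw [← P_flip h hi, P_eq h hi, e2]
    · rw [show n - (i + 1) + 1 = n - i by omega, ← P_flip h hi.le, P_eq h hi.le, e1]

/-- Distance at most `l` in the subdivision. -/
def Near (G : SimpleGraph V) (n l : ℕ) (x y : SubdivVert G n) : Prop :=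
  ∃ w : (subdivision G n).Walk x y, w.length ≤ l

lemma Near.symm {l : ℕ} {x y : SubdivVert G n} (h : Near G n l x y) : Near G n l y x := by
  obtain ⟨w, hw⟩ := h
  exact ⟨w.reverse, by simpa using hw⟩

lemma Near.mono {l k : ℕ} {x y : SubdivVert G n} (h : Near G n l x y) (hk : l ≤ k) :
    Near G n k x y := by
  obtain ⟨w, hw⟩ := h
  exact ⟨w, hw.trans hk⟩

lemma Near.trans {l k : ℕ} {x y z : SubdivVert G n} (h : Near G n l x y)
    (h' : Near G n k y z) : Near G n (l + k) x z := by
  obtain ⟨w, hw⟩ := h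
  obtain ⟨w', hw'⟩ := h'
  exact ⟨w.append w', by rw [SimpleGraph.Walk.length_append]; omega⟩

lemma Near.rfl' (x : SubdivVert G n) : Near G n 0 x x := ⟨SimpleGraph.Walk.nil, by simp⟩

lemma near_add {u v : V} (h : G.Adj u v) (i k : ℕ) (hik : i + k ≤ n) :
    Near G n k (P G n u v i) (P G n u v (i + k)) := by
  induction k with
  | zero => exact Near.rfl' _
  | succ k ih =>
    refine (ih (by omega)).trans ?_
    by_cases e : P G n u v (i + k) = P G n u v (i + (k + 1))
    · rw [← e]; exact (Near.rfl' _).mono (by omega)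
    · have : (subdivision G n).Adj (P G n u v (i + k)) (P G n u v (i + (k + 1))) := by
        rw [subdivision, SimpleGraph.fromRel_adj]
        refine ⟨e, Or.inl ⟨u, v, h, i + k, by omega, ?_, ?_⟩⟩
        · rw [P_eq h]
        · rw [P_eq h (by omega)]; rfl
      exact ⟨this.toWalk, by simp⟩

lemma near_edge {u v : V} (h : G.Adj u v) {i j l : ℕ} (hi : i ≤ n) (hj : j ≤ n)
    (h1 : i ≤ j + l) (h2 : j ≤ i + l) : Near G n l (P G n u v i) (P G n u v j) := by
  rcases le_total i j with hij | hij
  · have := near_add h i (j - i) (n := n) (by omega)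
    rw [show i + (j - i) = j by omega] at this
    exact this.mono (by omega)
  · have := near_add h j (i - j) (n := n) (by omega)
    rw [show j + (i - j) = i by omega] at this
    exact this.symm.mono (by omega)

lemma near_star {u v w : V} (h : G.Adj u v) (h' : G.Adj u w) {i j l : ℕ} (hi : i ≤ n)
    (hj : j ≤ n) (hl : i + j ≤ l) : Near G n l (P G n u v i) (P G n u w j) := by
  have h1 : Near G n i (P G n u v i) (P G n u v 0) :=
    near_edge h hi (Nat.zero_le n) (by omega) (by omega)
  have h2 : Near G n j (P G n u w 0) (P G n u w j) :=
    near_edge h' (Nat.zero_le n) hj (by omega) (by omega)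
  rw [P_zero] at h1 h2
  exact (h1.trans h2).mono hl

/-- Explicit description of closeness. -/
def Close (G : SimpleGraph V) (n l : ℕ) (x y : SubdivVert G n) : Prop :=
  x = y ∨
  (∃ u v w i j, G.Adj u v ∧ G.Adj u w ∧ i + j ≤ l ∧ x = P G n u v i ∧ y = P G n u w j) ∨
  (∃ u v i j, G.Adj u v ∧ i ≤ n ∧ j ≤ n ∧ i ≤ j + l ∧ j ≤ i + l ∧
    x = P G n u v i ∧ y = P G n u v j)

lemma P_zero' (u v w : V) : P G n u v 0 = P G n u w 0 := by rw [P_zero, P_zero]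

lemma close_step {l : ℕ} (hl : l + 1 < n) {x y z : SubdivVert G n} (h : Close G n l x y)
    (hz : (subdivision G n).Adj y z) : Close G n (l + 1) x z := by
  obtain ⟨a, b, p, hab, hp, ey, ez⟩ := sub_adj_rep hz
  have hn : 0 < n := by omega
  rcases h with rfl | ⟨u, v, w, i, j, huv, huw, hij, ex, ey'⟩ | ⟨u, v, i, j, huv, hi, hj, h1, h2, ex, ey'⟩
  · exact Or.inr (Or.inr ⟨a, b, p, p + 1, hab, by omega, by omega, by omega, by omega, ey, ez⟩)
  · right; left
    rcases P_inj hn huw (by omega) hab hp.le (ey'.symm.trans ey) with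
      ⟨rfl, rfl, rfl⟩ | ⟨rfl, rfl, e⟩ | ⟨rfl, rfl, rfl⟩ | ⟨e1, e2, e3⟩ | ⟨e1, e2, e3⟩ | ⟨e1, e2, e3⟩
    · exact ⟨u, v, w, i, j + 1, huv, huw, by omega, ex, ez⟩
    · refine ⟨u, v, w, i, j - 1, huv, huw, by omega, ex, ?_⟩
      rw [ez, P_flip hab (by omega)]
      congr 1; omega
    · exact ⟨u, v, b, i, 1, huv, hab, by omega, ex, ez⟩
    · omega
    · omega
    · omega
  · rcases P_inj hn huv hj hab hp.le (ey'.symm.trans ey) with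
      ⟨rfl, rfl, rfl⟩ | ⟨rfl, rfl, e⟩ | ⟨rfl, rfl, rfl⟩ | ⟨e1, e2, e3⟩ | ⟨rfl, rfl, rfl⟩ | ⟨e1, e2, e3⟩
    · right; right
      exact ⟨u, v, i, j + 1, huv, hi, by omega, by omega, by omega, ex, ez⟩
    · right; right
      refine ⟨u, v, i, j - 1, huv, hi, by omega, by omega, by omega, ex, ?_⟩
      rw [ez, P_flip hab (by omega)]
      congr 1; omega
    · right; left
      exact ⟨u, v, b, i, 1, huv, hab, by omega, ex, ez⟩
    · omega
    · right; left
      refine ⟨v, u, b, j - i, 1, huv.symm, hab, by omega, ?_, ez⟩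
      rw [ex, P_flip huv hi]
    · omega

lemma close_of_walk {x y : SubdivVert G n} (w : (subdivision G n).Walk x y) :
    w.length < n → Close G n w.length x y := by
  induction w using SimpleGraph.Walk.concatRec with
  | Hnil => intro _; exact Or.inl rfl
  | Hconcat p h ih =>
    intro hl
    rw [SimpleGraph.Walk.length_concat] at hl ⊢
    exact close_step hl (ih (by omega)) h

lemma Close.mono {l k : ℕ} {x y : SubdivVert G n} (h : Close G n l x y) (hk : l ≤ k) :
    Close G n k x y := by
  rcases h with rfl | ⟨u, v, w, i, j, huv, huw, hij, ex, ey'⟩ | ⟨u, v, i, j, huv, hi, hj, h1, h2, ex, ey'⟩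
  · exact Or.inl rfl
  · exact Or.inr (Or.inl ⟨u, v, w, i, j, huv, huw, by omega, ex, ey'⟩)
  · exact Or.inr (Or.inr ⟨u, v, i, j, huv, hi, hj, by omega, by omega, ex, ey'⟩)

lemma Near.close {l : ℕ} (hl : l < n) {x y : SubdivVert G n} (h : Near G n l x y) :
    Close G n l x y := by
  obtain ⟨w, hw⟩ := h
  exact (close_of_walk w (by omega)).mono hw

lemma fracPower_adj {m : ℕ} {x y : SubdivVert G n} :
    (fracPower G m n).Adj x y ↔ x ≠ y ∧ Near G n m x y := by
  rw [fracPower, powerGraph, SimpleGraph.fromRel_adj]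
  constructor
  · rintro ⟨h, h' | h'⟩
    · exact ⟨h, h'⟩
    · exact ⟨h, Near.symm h'⟩
  · rintro ⟨h, h'⟩
    exact ⟨h, Or.inl h'⟩

end

section
variable {V : Type*} {G : SimpleGraph V}

/-- The collapsing map on parameters. -/
def g (e : V → ℕ) (m n : ℕ) (u v : V) (i : ℕ) : ℕ :=
  if e u < e v then (if i ≤ m then i else i - m - 1) else (if i ≤ n then i else i - m - 1)

/-- The collapsing map. -/
noncomputable def φ (e : V → ℕ) (he : Function.Injective e) (m n : ℕ) (hmn : m < n) :
    SubdivVert G (n + m + 1) → SubdivVert G n :=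
  Quot.lift (fun p => P G n p.1.1 p.1.2.1 (g e m n p.1.1 p.1.2.1 p.1.2.2)) (by
    intro a b hab
    cases hab with
    | flip u v i h hi =>
      have h1 : e u ≠ e v := fun h' => h.ne (he h')
      simp only
      rw [P_flip h (by unfold g; split_ifs <;> omega)]
      congr 1
      unfold g
      split_ifs <;> omega
    | collapse u v h =>
      simp [g, P_zero])

lemma φ_P (e : V → ℕ) (he : Function.Injective e) (m n : ℕ) (hmn : m < n) {u v : V} (h : G.Adj u v) {i : ℕ}
    (hi : i ≤ n + m + 1) :
    φ e he m n hmn (P G (n + m + 1) u v i) = P G n u v (g e m n u v i) := by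
  rw [P_eq h hi]; rfl

lemma φ_adj (e : V → ℕ) (he : Function.Injective e) {m n : ℕ} (hmn : m < n)
    {x y : SubdivVert G (n + m + 1)} (h : (fracPower G m (n + m + 1)).Adj x y) :
    (fracPower G m n).Adj (φ e he m n hmn x) (φ e he m n hmn y) := by
  rw [fracPower_adj] at h ⊢
  obtain ⟨hne, h⟩ := h
  have hn : 0 < n := by omega
  rcases h.close (by omega) with rfl | ⟨u, v, w, i, j, huv, huw, hij, ex, ey⟩ | ⟨u, v, i, j, huv, hi, hj, h1, h2, ex, ey⟩
  · exact absurd rfl hne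
  · rw [ex, ey, φ_P e he m n hmn huv (by omega), φ_P e he m n hmn huw (by omega)]
    have g1 : g e m n u v i = i := by unfold g; split_ifs <;> omega
    have g2 : g e m n u w j = j := by unfold g; split_ifs <;> omega
    rw [g1, g2]
    refine ⟨fun heq => hne ?_, near_star huv huw (by omega) (by omega) hij⟩
    rw [ex, ey]
    rcases P_inj hn huv (by omega) huw (by omega) heq with
      ⟨-, rfl, rfl⟩ | ⟨rfl, rfl, e⟩ | ⟨rfl, rfl, -⟩ | ⟨e1, e2, e3⟩ | ⟨e1, e2, e3⟩ | ⟨e1, e2, e3⟩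
    · rfl
    · exact absurd rfl huv.ne
    · exact P_zero' _ _ _
    · omega
    · omega
    · omega
  · rw [ex, ey, φ_P e he m n hmn huv (by omega), φ_P e he m n hmn huv (by omega)]
    have hij : i ≠ j := by
      rintro rfl
      exact hne (ex.trans ey.symm)
    have b1 : g e m n u v i ≤ n := by unfold g; split_ifs <;> omega
    have b2 : g e m n u v j ≤ n := by unfold g; split_ifs <;> omega
    refine ⟨fun heq => ?_, near_edge huv b1 b2
      (by unfold g; split_ifs <;> omega) (by unfold g; split_ifs <;> omega)⟩
    have : g e m n u v i ≠ g e m n u v j := by unfold g; split_ifs <;> omega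
    have := huv.ne
    rcases P_inj hn huv b1 huv b2 heq with
      ⟨-, -, h⟩ | ⟨h, -⟩ | ⟨e1, e2, e3⟩ | ⟨e1, e2, e3⟩ | ⟨e1, e2, e3⟩ | ⟨e1, e2, e3⟩
    · contradiction
    · contradiction
    · omega
    · contradiction
    · exact huv.ne e3.symm
    · omega

lemma chrom_le [Fintype V] {m n : ℕ} (hmn : m < n) :
    (fracPower G m (n + m + 1)).chromaticNumber ≤ (fracPower G m n).chromaticNumber := by
  let e : V → ℕ := fun v => (Fintype.equivFin V v : ℕ)
  have he : Function.Injective e := fun a b h =>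
    (Fintype.equivFin V).injective (Fin.ext h)
  let f : fracPower G m (n + m + 1) →g fracPower G m n := ⟨φ e he m n hmn, fun h => φ_adj e he hmn h⟩
  exact SimpleGraph.chromaticNumber_mono_of_hom f

instance [Fintype V] (n : ℕ) : Finite (SubdivVert G n) := by
  let f : V ⊕ (V × V × Fin (n + 1)) → SubdivVert G n := fun s =>
    s.elim (branchVertex G n) (fun p => P G n p.1 p.2.1 p.2.2)
  refine Finite.of_surjective f (fun x => ?_)
  rcases exists_rep x with ⟨u, rfl⟩ | ⟨u, v, i, h, h0, hi, rfl⟩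
  · exact ⟨Sum.inl u, rfl⟩
  · exact ⟨Sum.inr (u, v, ⟨i, by omega⟩), rfl⟩

/-- Lying on an edge at `u`. -/
def Star (G : SimpleGraph V) (n : ℕ) (u : V) (x : SubdivVert G n) : Prop :=
  ∃ v i, G.Adj u v ∧ i ≤ n ∧ x = P G n u v i

lemma star_near {m n : ℕ} (hmn : m < n) {u v w : V} {i j : ℕ} (huv : G.Adj u v)
    (huw : G.Adj u w) (hi : i ≤ n) (hj : j ≤ n)
    (h : Near G n m (P G n u v i) (P G n u w j)) :
    (v = w ∧ i ≤ j + m ∧ j ≤ i + m) ∨ i + j ≤ m := by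
  have hn : 0 < n := by omega
  have n1 := huv.ne
  have n2 := huw.ne
  rcases h.close hmn with h | ⟨a, b, c, p, q, hab, hac, hpq, ex, ey⟩ | ⟨a, b, p, q, hab, hp, hq, h1, h2, ex, ey⟩
  · have := P_inj hn huv hi huw hj h
    grind (splits := 20)
  · have n3 := hab.ne
    have n4 := hac.ne
    have e1 := P_inj hn huv hi hab (by omega) ex
    have e2 := P_inj hn huw hj hac (by omega) ey
    clear h ex ey
    grind (splits := 20)
  · have n3 := hab.ne
    have e1 := P_inj hn huv hi hab hp ex
    have e2 := P_inj hn huw hj hab hq ey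
    clear h ex ey
    grind (splits := 20)

/-- A point near an interior point of `uv` and not in the star of `v` is off-edge at `u`. -/
lemma off_star {m n : ℕ} (hmn : m < n) {u v : V} {i : ℕ} (huv : G.Adj u v)
    (h0 : 0 < i) (hi : i < n) {y : SubdivVert G n}
    (h : Near G n m (P G n u v i) y) (hy : ¬ Star G n v y) :
    ∃ w j, G.Adj u w ∧ w ≠ v ∧ 0 < j ∧ i + j ≤ m ∧ y = P G n u w j := by
  have hn : 0 < n := by omega
  have key : ∀ k, k ≤ n → y ≠ P G n u v k := by
    intro k hk e
    exact hy ⟨u, n - k, huv.symm, by omega, by rw [e, P_flip huv hk]⟩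
  rcases h.close hmn with h | ⟨a, b, c, p, q, hab, hac, hpq, ex, ey⟩ | ⟨a, b, p, q, hab, hp, hq, h1, h2, ex, ey⟩
  · exact absurd h.symm (key i hi.le)
  · rcases P_inj hn huv hi.le hab (by omega) ex with
      ⟨rfl, rfl, rfl⟩ | ⟨rfl, rfl, e⟩ | ⟨e1, e2, e3⟩ | ⟨e1, e2, e3⟩ | ⟨e1, e2, e3⟩ | ⟨e1, e2, e3⟩
    · refine ⟨c, q, hac, ?_, ?_, hpq, ey⟩
      · rintro rfl
        exact key q (by omega) ey
      · rcases Nat.eq_zero_or_pos q with rfl | hq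
        · exact absurd (ey.trans (P_zero' _ _ _)) (key 0 (by omega))
        · exact hq
    · exact absurd ⟨c, q, hac, by omega, ey⟩ hy
    all_goals omega
  · rcases P_inj hn huv hi.le hab hp ex with
      ⟨rfl, rfl, rfl⟩ | ⟨rfl, rfl, e⟩ | ⟨e1, e2, e3⟩ | ⟨e1, e2, e3⟩ | ⟨e1, e2, e3⟩ | ⟨e1, e2, e3⟩
    · exact absurd ey (key q hq)
    · exact absurd ⟨u, q, hab, hq, ey⟩ hy
    all_goals omega

lemma star_or {m n : ℕ} (hmn : m < n) {u v : V} {i : ℕ} (huv : G.Adj u v)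
    (h0 : 0 < i) (hi : i < n) {y z : SubdivVert G n}
    (hy : Near G n m (P G n u v i) y) (hz : Near G n m (P G n u v i) z) (hyz : Near G n m y z) :
    Star G n v y ∨ Star G n u z := by
  by_contra hcon
  push Not at hcon
  obtain ⟨hy', hz'⟩ := hcon
  have hn : 0 < n := by omega
  obtain ⟨w, j, huw, hwv, hj, hij, rfl⟩ := off_star hmn huv h0 hi hy hy'
  rw [P_flip huv hi.le] at hz
  obtain ⟨t, k, hvt, htu, hk, hik, rfl⟩ :=
    off_star hmn huv.symm (by omega) (by omega) hz hz'
  have n1 := huv.ne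
  have n2 := huw.ne
  have n3 := hvt.ne
  rcases hyz.close hmn with h | ⟨a, b, c, p, q, hab, hac, hpq, ex, ey⟩ | ⟨a, b, p, q, hab, hp, hq, h1, h2, ex, ey⟩
  · have := P_inj hn huw (by omega) hvt (by omega) h
    grind (splits := 20)
  · have n3 := hab.ne
    have n4 := hac.ne
    have e1 := P_inj hn huw (by omega) hab (by omega) ex
    have e2 := P_inj hn hvt (by omega) hac (by omega) ey
    clear hy hz hy' hz' hyz ex ey
    grind (splits := 20)
  · have n3 := hab.ne
    have e1 := P_inj hn huw (by omega) hab hp ex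
    have e2 := P_inj hn hvt (by omega) hab hq ey
    clear hy hz hy' hz' hyz ex ey
    grind (splits := 20)

lemma branch_eq {m n : ℕ} (hmn : m < n) {x y : SubdivVert G n} (h : Near G n m x y)
    (hx : ¬ ∃ u v i, G.Adj u v ∧ 0 < i ∧ i < n ∧ x = P G n u v i)
    (hy : ¬ ∃ u v i, G.Adj u v ∧ 0 < i ∧ i < n ∧ y = P G n u v i) : x = y := by
  rcases h.close hmn with h | ⟨a, b, c, p, q, hab, hac, hpq, ex, ey⟩ | ⟨a, b, p, q, hab, hp, hq, h1, h2, ex, ey⟩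
  · exact h
  · have hp : p = 0 := by
      by_contra h0
      exact hx ⟨a, b, p, hab, by omega, by omega, ex⟩
    have hq : q = 0 := by
      by_contra h0
      exact hy ⟨a, c, q, hac, by omega, by omega, ey⟩
    rw [ex, ey, hp, hq]
    exact P_zero' _ _ _
  · have hp : ¬ (0 < p ∧ p < n) := fun h => hx ⟨a, b, p, hab, h.1, h.2, ex⟩
    have hq : ¬ (0 < q ∧ q < n) := fun h => hy ⟨a, b, q, hab, h.1, h.2, ey⟩
    rw [ex, ey, show p = q by omega]

lemma star_clique {m n : ℕ} (hmn : m < n) {u : V} (s : Finset (SubdivVert G n))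
    (hs : (fracPower G m n).IsClique s) (hu : ∀ x ∈ s, Star G n u x) :
    ∃ t, (fracPower G m (n + m + 1)).IsNClique s.card t := by
  classical
  have hu' : ∀ x : SubdivVert G n, ∃ q : V × ℕ, x ∈ s →
      G.Adj u q.1 ∧ q.2 ≤ n ∧ x = P G n u q.1 q.2 := by
    intro x
    by_cases hx : x ∈ s
    · obtain ⟨v, i, h⟩ := hu x hx
      exact ⟨(v, i), fun _ => h⟩
    · exact ⟨(u, 0), fun h => absurd h hx⟩
  choose q hq using hu'
  let ψ : SubdivVert G n → SubdivVert G (n + m + 1) := fun x => P G (n + m + 1) u (q x).1 (q x).2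
  have key : ∀ x ∈ s, ∀ y ∈ s, x ≠ y → (fracPower G m (n + m + 1)).Adj (ψ x) (ψ y) := by
    intro x hx y hy hxy
    obtain ⟨a1, b1, c1⟩ := hq x hx
    obtain ⟨a2, b2, c2⟩ := hq y hy
    have hadj := (fracPower_adj.1 (hs hx hy hxy)).2
    rw [fracPower_adj]
    show P G (n + m + 1) u (q x).1 (q x).2 ≠ P G (n + m + 1) u (q y).1 (q y).2 ∧
      Near G (n + m + 1) m (P G (n + m + 1) u (q x).1 (q x).2)
        (P G (n + m + 1) u (q y).1 (q y).2)
    generalize (q x).1 = v at *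
    generalize (q x).2 = i at *
    generalize (q y).1 = w at *
    generalize (q y).2 = j at *
    constructor
    · intro heq
      apply hxy
      rw [c1, c2]
      rcases P_inj (by omega) a1 (by omega) a2 (by omega) heq with
        ⟨-, rfl, rfl⟩ | ⟨rfl, rfl, e⟩ | ⟨rfl, rfl, -⟩ | ⟨e1, e2, e3⟩ | ⟨e1, e2, e3⟩ | ⟨e1, e2, e3⟩
      · rfl
      · exact absurd rfl a1.ne
      · exact P_zero' _ _ _
      all_goals omega
    · rw [c1, c2] at hadj
      rcases star_near hmn a1 a2 b1 b2 hadj with ⟨rfl, h1, h2⟩ | h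
      · exact near_edge a1 (by omega) (by omega) h1 h2
      · exact near_star a1 a2 (by omega) (by omega) h
  refine ⟨s.image ψ, ?_, ?_⟩
  · intro a ha b hb hab
    simp only [Finset.coe_image, Set.mem_image, Finset.mem_coe] at ha hb
    obtain ⟨x, hx, rfl⟩ := ha
    obtain ⟨y, hy, rfl⟩ := hb
    exact key x hx y hy (fun h => hab (by rw [h]))
  · apply Finset.card_image_of_injOn
    intro x hx y hy hxy
    by_contra hne
    exact (key x hx y hy hne).ne hxy

lemma clique_lift {m n : ℕ} (hmn : m < n) (s : Finset (SubdivVert G n))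
    (hs : (fracPower G m n).IsClique s) :
    ∃ t, (fracPower G m (n + m + 1)).IsNClique s.card t := by
  by_cases hex : ∃ x ∈ s, ∃ u v i, G.Adj u v ∧ 0 < i ∧ i < n ∧ x = P G n u v i
  · obtain ⟨x, hx, u, v, i, huv, h0, hi, rfl⟩ := hex
    have near : ∀ y ∈ s, ∀ z ∈ s, Near G n m y z := by
      intro y hy z hz
      by_cases h : y = z
      · subst h; exact (Near.rfl' y).mono (by omega)
      · exact (fracPower_adj.1 (hs hy hz h)).2
    by_cases hv : ∀ y ∈ s, Star G n v y
    · exact star_clique hmn s hs hv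
    · push Not at hv
      obtain ⟨y, hy, hy'⟩ := hv
      refine star_clique hmn (u := u) s hs (fun z hz => ?_)
      exact (star_or hmn huv h0 hi (near _ hx y hy) (near _ hx z hz)
        (near y hy z hz)).resolve_left hy'
  · push Not at hex
    have hc : s.card ≤ 1 := by
      rw [Finset.card_le_one]
      intro x hx y hy
      by_contra hne
      refine hne (branch_eq hmn (fracPower_adj.1 (hs hx hy hne)).2 ?_ ?_)
      · rintro ⟨u, v, i, h1, h2, h3, h4⟩
        exact hex x hx u v i h1 h2 h3 h4
      · rintro ⟨u, v, i, h1, h2, h3, h4⟩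
        exact hex y hy u v i h1 h2 h3 h4
    rcases Nat.eq_zero_or_pos s.card with h | h
    · rw [h]; exact ⟨∅, by simp⟩
    · have h1 : s.card = 1 := by omega
      obtain ⟨x, hx⟩ := Finset.card_pos.1 h
      have : ∃ u : V, True := by
        rcases exists_rep x with ⟨u, -⟩ | ⟨u, -⟩ <;> exact ⟨u, trivial⟩
      obtain ⟨u, -⟩ := this
      rw [h1]
      exact ⟨{branchVertex G _ u}, by simp⟩

lemma clique_le [Fintype V] {m n : ℕ} (hmn : m < n) :
    (fracPower G m n).cliqueNum ≤ (fracPower G m (n + m + 1)).cliqueNum := by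
  obtain ⟨s, hs⟩ := (fracPower G m n).exists_isNClique_cliqueNum
  obtain ⟨t, ht⟩ := clique_lift hmn s hs.isClique
  rw [hs.card_eq] at ht
  have := ht.isClique.card_le_cliqueNum
  rwa [ht.card_eq] at this

end

end FracAux

theorem chromatic_le_clique_add_lift {V : Type*} [Fintype V] (G : SimpleGraph V)
    (m n c : ℕ) (hm : 0 < m) (hmn : m < n)
    (h : (fracPower G m n).chromaticNumber ≤ (((fracPower G m n).cliqueNum + c : ℕ) : ℕ∞)) :
    (fracPower G m (n + m + 1)).chromaticNumber ≤
      (((fracPower G m (n + m + 1)).cliqueNum + c : ℕ) : ℕ∞) := by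
  exact (FracAux.chrom_le hmn).trans (h.trans (by
    exact_mod_cast Nat.add_le_add_right (FracAux.clique_le hmn) c))
end

section
/- Let G be a connected finite simple graph with maximum degree Δ(G) ≥ 3, let m be a positive integer, and let c be a nonnegative integer. If χ(G^{m/n}) ≤ ω(G^{m/n}) + c for every n with m+2 ≤ n ≤ 2m+1, then χ(G^{m/n}) ≤ ω(G^{m/n}) + c for every integer n with n > m. -/
open SimpleGraph

/-- The point at position `i` on the path of the edge `uv`, with a default value. -/
noncomputable def PP {V : Type*} (G : SimpleGraph V) (n : ℕ) (u v : V) (i : ℕ) : SubdivVert G n :=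
  open Classical in
  if h : G.Adj u v ∧ i ≤ n then mkVert G n h.1 i h.2 else branchVertex G n u

theorem PP_eq {V : Type*} {G : SimpleGraph V} {n : ℕ} {u v : V} {i : ℕ} (h : G.Adj u v)
    (hi : i ≤ n) : mkVert G n h i hi = PP G n u v i := by
  simp [PP, h, hi]

theorem PP_flip {V : Type*} {G : SimpleGraph V} {n : ℕ} {u v : V} {i j : ℕ} (h : G.Adj u v)
    (hi : i + j = n) : PP G n u v i = PP G n v u j := by
  have hi' : i ≤ n := by omega
  have hj : j = n - i := by omega
  subst hj
  rw [← PP_eq h hi', ← PP_eq h.symm (by omega)]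
  exact Quot.sound (SubdivRel.flip u v i h hi')

theorem PP_zero {V : Type*} {G : SimpleGraph V} {n : ℕ} {u v : V} :
    PP G n u v 0 = branchVertex G n u := by
  by_cases h : G.Adj u v
  · rw [← PP_eq h (Nat.zero_le n)]
    exact Quot.sound (SubdivRel.collapse u v h)
  · simp [PP, h]

theorem PP_end {V : Type*} {G : SimpleGraph V} {n : ℕ} {u v : V} (h : G.Adj u v) :
    PP G n u v n = branchVertex G n v := by
  rw [PP_flip h (j := 0) (by omega), PP_zero]

theorem PP_self {V : Type*} {G : SimpleGraph V} {n : ℕ} {u : V} {i : ℕ} :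
    PP G n u u i = branchVertex G n u := by
  simp [PP]

theorem PP_surj {V : Type*} {G : SimpleGraph V} (hG : ∀ u, ∃ v, G.Adj u v) {n : ℕ}
    (x : SubdivVert G n) : ∃ u v i, G.Adj u v ∧ i ≤ n ∧ x = PP G n u v i := by
  induction x using Quot.ind with
  | mk p =>
    obtain ⟨⟨u, v, i⟩, hp⟩ := p
    by_cases h : G.Adj u v ∧ i ≤ n
    · exact ⟨u, v, i, h.1, h.2, PP_eq h.1 h.2⟩
    · have hp' : u = v ∧ i = 0 := by
        rcases hp with hp | hp
        · exact hp
        · exact absurd hp h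
      obtain ⟨rfl, rfl⟩ := hp'
      obtain ⟨w, hw⟩ := hG u
      exact ⟨u, w, 0, hw, Nat.zero_le _, PP_zero.symm⟩

/-- Normal form of a representation. -/
def preNF {V : Type*} (G : SimpleGraph V) (n : ℕ) (p : SubdivPre G n) : V ⊕ Sym2 (V × V × ℕ) :=
  if p.1.2.2 = 0 then Sum.inl p.1.1 else if p.1.2.2 = n then Sum.inl p.1.2.1 else
    Sum.inr s((p.1.1, p.1.2.1, p.1.2.2), (p.1.2.1, p.1.1, n - p.1.2.2))

theorem preNF_rel {V : Type*} (G : SimpleGraph V) {n : ℕ} (hn : 0 < n) (p q : SubdivPre G n)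
    (h : SubdivRel G n p q) : preNF G n p = preNF G n q := by
  cases h with
  | flip u v i h hi =>
    simp only [preNF]
    by_cases h0 : i = 0
    · subst h0
      simp [hn.ne']
    · by_cases h1 : i = n
      · subst h1
        simp [hn.ne']
      · have h2 : n - i ≠ 0 := by omega
        have h3 : n - i ≠ n := by omega
        have h4 : n - (n - i) = i := by omega
        simp only [h0, h1, h2, h3, h4, if_false]
        rw [Sym2.eq_swap]
  | collapse u v h => simp [preNF]

theorem PP_inj {V : Type*} {G : SimpleGraph V} {n : ℕ} (hn : 0 < n) {u v u' v' : V} {i j : ℕ}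
    (h : G.Adj u v) (h' : G.Adj u' v') (hi : i ≤ n) (hj : j ≤ n)
    (e : PP G n u v i = PP G n u' v' j) :
    (u = u' ∧ v = v' ∧ i = j) ∨ (u = v' ∧ v = u' ∧ i + j = n) ∨ (i = 0 ∧ j = 0 ∧ u = u') ∨
    (i = 0 ∧ j = n ∧ u = v') ∨ (i = n ∧ j = 0 ∧ v = u') ∨ (i = n ∧ j = n ∧ v = v') := by
  rw [← PP_eq h hi, ← PP_eq h' hj] at e
  have := congrArg (Quot.lift (preNF G n) (preNF_rel G hn)) e
  simp only [mkVert, preNF] at this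
  split_ifs at this <;> simp at this <;> grind

/-- Explicit description of closeness. -/
def Close {V : Type*} (G : SimpleGraph V) (n m : ℕ) (x y : SubdivVert G n) : Prop :=
  (∃ u v i j, G.Adj u v ∧ i ≤ n ∧ j ≤ n ∧ i ≤ j + m ∧ j ≤ i + m ∧
    x = PP G n u v i ∧ y = PP G n u v j) ∨
  (∃ b v w i j, G.Adj b v ∧ G.Adj b w ∧ i + j ≤ m ∧ x = PP G n b v i ∧ y = PP G n b w j)

theorem subdiv_adj {V : Type*} {G : SimpleGraph V} {n : ℕ} {x y : SubdivVert G n}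
    (h : (subdivision G n).Adj x y) : ∃ u v i, G.Adj u v ∧ i + 1 ≤ n ∧
      x = PP G n u v i ∧ y = PP G n u v (i + 1) := by
  obtain ⟨_, h | h⟩ := h
  · obtain ⟨u, v, h, i, hi, rfl, rfl⟩ := h
    exact ⟨u, v, i, h, hi, PP_eq _ _, PP_eq _ _⟩
  · obtain ⟨u, v, h, i, hi, rfl, rfl⟩ := h
    refine ⟨v, u, n - (i + 1), h.symm, by omega, ?_, ?_⟩
    · rw [PP_eq]; exact PP_flip h (by omega)
    · rw [PP_eq]; exact PP_flip h (by omega)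

theorem subdiv_walk {V : Type*} {G : SimpleGraph V} {n : ℕ} {u v : V} (h : G.Adj u v) (i d : ℕ)
    (hi : i + d ≤ n) :
    ∃ w : (subdivision G n).Walk (PP G n u v i) (PP G n u v (i + d)), w.length ≤ d := by
  induction d with
  | zero => exact ⟨Walk.nil, by simp⟩
  | succ d ih =>
    obtain ⟨w, hw⟩ := ih (by omega)
    by_cases e : PP G n u v (i + d) = PP G n u v (i + (d + 1))
    · rw [← e]; exact ⟨w, by omega⟩
    · have ha : (subdivision G n).Adj (PP G n u v (i + d)) (PP G n u v (i + (d + 1))) :=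
        ⟨e, Or.inl ⟨u, v, h, i + d, by omega, (PP_eq _ _).symm, (PP_eq _ _).symm⟩⟩
      exact ⟨w.concat ha, by simp; omega⟩

theorem close_step {V : Type*} {G : SimpleGraph V} {n m : ℕ} (hm : m < n)
    {x y z : SubdivVert G n} (h : Close G n m x y) (ha : (subdivision G n).Adj y z) :
    Close G n (m + 1) x z := by
  obtain ⟨s, t, k, hst, hk, rfl, rfl⟩ := subdiv_adj ha
  rcases h with ⟨u, v, i, j, huv, hi, hj, h1, h2, rfl, e⟩ | ⟨b, v, w, i, j, hbv, hbw, hij, rfl, e⟩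
  · rcases PP_inj (by omega) hst huv (by omega) hj e with h | h | h | h | h | h
    · obtain ⟨rfl, rfl, rfl⟩ := h
      exact Or.inl ⟨s, t, i, k + 1, hst, hi, hk, by omega, by omega, rfl, rfl⟩
    · obtain ⟨rfl, rfl, h⟩ := h
      exact Or.inl ⟨t, s, i, n - (k + 1), huv, hi, by omega, by omega, by omega, rfl,
        PP_flip hst (by omega)⟩
    · obtain ⟨rfl, rfl, rfl⟩ := h
      exact Or.inr ⟨s, v, t, i, 1, huv, hst, by omega, rfl, rfl⟩
    · obtain ⟨rfl, rfl, rfl⟩ := h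
      exact Or.inr ⟨s, u, t, j - i, 1, huv.symm, hst, by omega, PP_flip huv (by omega), rfl⟩
    · omega
    · omega
  · rcases PP_inj (by omega) hst hbw (by omega) (by omega) e with h | h | h | h | h | h
    · obtain ⟨rfl, rfl, rfl⟩ := h
      exact Or.inr ⟨s, v, t, i, k + 1, hbv, hst, by omega, rfl, rfl⟩
    · obtain ⟨rfl, rfl, h⟩ := h
      exact Or.inr ⟨t, v, s, i, n - (k + 1), hbv, hbw, by omega, rfl, PP_flip hst (by omega)⟩
    · obtain ⟨rfl, rfl, rfl⟩ := h
      exact Or.inr ⟨s, v, t, i, 1, hbv, hst, by omega, rfl, rfl⟩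
    · omega
    · omega
    · omega

theorem close_mono {V : Type*} {G : SimpleGraph V} {n m m' : ℕ} (hm : m ≤ m')
    {x y : SubdivVert G n} (h : Close G n m x y) : Close G n m' x y := by
  rcases h with ⟨u, v, i, j, huv, hi, hj, h1, h2, e1, e2⟩ | ⟨b, v, w, i, j, hbv, hbw, hij, e1, e2⟩
  · exact Or.inl ⟨u, v, i, j, huv, hi, hj, by omega, by omega, e1, e2⟩
  · exact Or.inr ⟨b, v, w, i, j, hbv, hbw, by omega, e1, e2⟩

theorem close_refl {V : Type*} {G : SimpleGraph V} (hG : ∀ u, ∃ v, G.Adj u v) {n : ℕ} (m : ℕ)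
    (x : SubdivVert G n) : Close G n m x x := by
  obtain ⟨u, v, i, h, hi, rfl⟩ := PP_surj hG x
  exact Or.inl ⟨u, v, i, i, h, hi, hi, by omega, by omega, rfl, rfl⟩

theorem close_symm {V : Type*} {G : SimpleGraph V} {n m : ℕ}
    {x y : SubdivVert G n} (h : Close G n m x y) : Close G n m y x := by
  rcases h with ⟨u, v, i, j, huv, hi, hj, h1, h2, e1, e2⟩ | ⟨b, v, w, i, j, hbv, hbw, hij, e1, e2⟩
  · exact Or.inl ⟨u, v, j, i, huv, hj, hi, by omega, by omega, e2, e1⟩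
  · exact Or.inr ⟨b, w, v, j, i, hbw, hbv, by omega, e2, e1⟩

theorem close_of_walk {V : Type*} {G : SimpleGraph V} (hG : ∀ u, ∃ v, G.Adj u v) {n : ℕ}
    {x y : SubdivVert G n} (w : (subdivision G n).Walk x y) (hw : w.length < n) :
    Close G n w.length y x := by
  induction w with
  | nil => exact close_refl hG _ _
  | cons h p ih =>
    simp only [Walk.length_cons] at hw ⊢
    exact close_step (by omega) (ih (by omega)) h.symm

theorem walk_of_close {V : Type*} {G : SimpleGraph V} {n m : ℕ} (hm : m < n)
    {x y : SubdivVert G n} (h : Close G n m x y) :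
    ∃ w : (subdivision G n).Walk x y, w.length ≤ m := by
  rcases h with ⟨u, v, i, j, huv, hi, hj, h1, h2, rfl, rfl⟩ |
    ⟨b, v, w, i, j, hbv, hbw, hij, rfl, rfl⟩
  · rcases le_total i j with hle | hle
    · obtain ⟨d, rfl⟩ := Nat.exists_eq_add_of_le hle
      obtain ⟨w, hw⟩ := subdiv_walk huv i d hj
      exact ⟨w, by omega⟩
    · obtain ⟨d, rfl⟩ := Nat.exists_eq_add_of_le hle
      obtain ⟨w, hw⟩ := subdiv_walk huv j d hi
      exact ⟨w.reverse, by simp; omega⟩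
  · obtain ⟨w1, hw1⟩ := subdiv_walk (n := n) hbv 0 i (by omega)
    obtain ⟨w2, hw2⟩ := subdiv_walk (n := n) hbw 0 j (by omega)
    refine ⟨((w1.copy PP_zero (by rw [zero_add])).reverse).append
      (w2.copy PP_zero (by rw [zero_add])), ?_⟩
    simp only [Walk.length_append, Walk.length_reverse, Walk.length_copy]
    omega

theorem frac_adj {V : Type*} {G : SimpleGraph V} (hG : ∀ u, ∃ v, G.Adj u v) {n m : ℕ} (hm : m < n)
    {x y : SubdivVert G n} : (fracPower G m n).Adj x y ↔ x ≠ y ∧ Close G n m x y := by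
  constructor
  · rintro ⟨hne, h⟩
    refine ⟨hne, ?_⟩
    rcases h with ⟨w, hw⟩ | ⟨w, hw⟩
    · exact close_symm (close_mono hw (close_of_walk hG w (by omega)))
    · exact close_mono hw (close_of_walk hG w (by omega))
  · rintro ⟨hne, h⟩
    exact ⟨hne, Or.inl (walk_of_close hm h)⟩

/-- Position map removing `m + 1` points. -/
def cutPos (m i : ℕ) : ℕ := if i ≤ m then i else i - (m + 1)

/-- The map `G^{1/(n+m+1)} → G^{1/n}` on representations. -/
noncomputable def cutPre {V : Type*} [LinearOrder V] (G : SimpleGraph V) (n m : ℕ)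
    (p : SubdivPre G (n + (m + 1))) : SubdivVert G n :=
  if p.1.1 < p.1.2.1 then PP G n p.1.1 p.1.2.1 (cutPos m p.1.2.2)
  else PP G n p.1.2.1 p.1.1 (cutPos m (n + (m + 1) - p.1.2.2))

theorem cutPos_end {n m : ℕ} : cutPos m (n + (m + 1)) = n := by
  unfold cutPos; split_ifs <;> omega

theorem cutPre_rel {V : Type*} [LinearOrder V] (G : SimpleGraph V) (n m : ℕ)
    (p q : SubdivPre G (n + (m + 1))) (h : SubdivRel G _ p q) :
    cutPre G n m p = cutPre G n m q := by
  cases h with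
  | flip u v i h hi =>
    simp only [cutPre]
    rcases lt_or_gt_of_ne h.ne with h1 | h1
    · rw [if_pos h1, if_neg h1.not_gt]
      congr 2
      omega
    · rw [if_neg h1.not_gt, if_pos h1]
  | collapse u v h =>
    simp only [cutPre, lt_irrefl, if_false, PP_self]
    rcases lt_or_gt_of_ne h.ne with h1 | h1
    · rw [if_pos h1, show cutPos m 0 = 0 by simp [cutPos], PP_zero]
    · rw [if_neg h1.not_gt, Nat.sub_zero, cutPos_end, PP_end h.symm]

/-- The map `G^{1/(n+m+1)} → G^{1/n}`. -/
noncomputable def cutMap {V : Type*} [LinearOrder V] (G : SimpleGraph V) (n m : ℕ) :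
    SubdivVert G (n + (m + 1)) → SubdivVert G n :=
  Quot.lift (cutPre G n m) (cutPre_rel G n m)

theorem cutMap_lt {V : Type*} [LinearOrder V] {G : SimpleGraph V} {n m : ℕ} {u v : V}
    (h : G.Adj u v) (hlt : u < v) {i : ℕ} (hi : i ≤ n + (m + 1)) :
    cutMap G n m (PP G _ u v i) = PP G n u v (cutPos m i) := by
  rw [← PP_eq h hi]
  simp [cutMap, mkVert, cutPre, hlt]

theorem cutMap_near {V : Type*} [LinearOrder V] {G : SimpleGraph V} {n m : ℕ} (hn : m < n)
    {u v : V} (h : G.Adj u v) {i : ℕ} (hi : i ≤ m) :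
    cutMap G n m (PP G _ u v i) = PP G n u v i := by
  rcases lt_or_gt_of_ne h.ne with h1 | h1
  · rw [cutMap_lt h h1 (by omega)]
    simp [cutPos, hi]
  · rw [PP_flip h (j := n + (m + 1) - i) (by omega), cutMap_lt h.symm h1 (by omega)]
    have : cutPos m (n + (m + 1) - i) = n - i := by
      unfold cutPos; split_ifs <;> omega
    rw [this]
    exact PP_flip h.symm (by omega)

theorem PP_inj_same {V : Type*} {G : SimpleGraph V} {n : ℕ} (hn : 0 < n) {u v : V} {i j : ℕ}
    (h : G.Adj u v) (hi : i ≤ n) (hj : j ≤ n) (e : PP G n u v i = PP G n u v j) : i = j := by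
  have := h.ne
  rcases PP_inj hn h h hi hj e with h | h | h | h | h | h <;> grind

theorem PP_inj_near {V : Type*} {G : SimpleGraph V} {n : ℕ} (hn : 0 < n) {u v w : V} {i j : ℕ}
    (h : G.Adj u v) (h' : G.Adj u w) (hi : i < n) (hj : j ≤ n)
    (e : PP G n u v i = PP G n u w j) : i = j ∧ (i = 0 ∨ v = w) := by
  have := h.ne
  have := h'.ne
  rcases PP_inj hn h h' hi.le hj e with h | h | h | h | h | h <;> grind

theorem cut_adj {V : Type*} [LinearOrder V] {G : SimpleGraph V} (hG : ∀ u, ∃ v, G.Adj u v)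
    {n m : ℕ} (hn : m < n) {x y : SubdivVert G (n + (m + 1))}
    (h : (fracPower G m (n + (m + 1))).Adj x y) :
    (fracPower G m n).Adj (cutMap G n m x) (cutMap G n m y) := by
  rw [frac_adj hG (by omega)] at h ⊢
  obtain ⟨hne, h⟩ := h
  have key : ∀ u v i j, G.Adj u v → u < v → i ≤ n + (m + 1) → j ≤ n + (m + 1) → i ≤ j + m →
      j ≤ i + m → x = PP G _ u v i → y = PP G _ u v j →
      cutMap G n m x ≠ cutMap G n m y ∧ Close G n m (cutMap G n m x) (cutMap G n m y) := by
    rintro u v i j huv hlt hi hj h1 h2 rfl rfl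
    have hij : i ≠ j := by rintro rfl; exact hne rfl
    rw [cutMap_lt huv hlt hi, cutMap_lt huv hlt hj]
    have a1 : cutPos m i ≤ n := by unfold cutPos; split_ifs <;> omega
    have a2 : cutPos m j ≤ n := by unfold cutPos; split_ifs <;> omega
    refine ⟨fun e => ?_, Or.inl ⟨u, v, _, _, huv, a1, a2, ?_, ?_, rfl, rfl⟩⟩
    · have := PP_inj_same (by omega) huv a1 a2 e
      unfold cutPos at this; split_ifs at this <;> omega
    · unfold cutPos; split_ifs <;> omega
    · unfold cutPos; split_ifs <;> omega
  rcases h with ⟨u, v, i, j, huv, hi, hj, h1, h2, e1, e2⟩ |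
    ⟨b, v, w, i, j, hbv, hbw, hij, rfl, rfl⟩
  · rcases lt_or_gt_of_ne huv.ne with hlt | hlt
    · exact key u v i j huv hlt hi hj h1 h2 e1 e2
    · rw [PP_flip huv (j := n + (m + 1) - i) (by omega)] at e1
      rw [PP_flip huv (j := n + (m + 1) - j) (by omega)] at e2
      exact key v u _ _ huv.symm hlt (by omega) (by omega) (by omega) (by omega) e1 e2
  · rw [cutMap_near hn hbv (by omega), cutMap_near hn hbw (by omega)]
    refine ⟨fun e => hne ?_, Or.inr ⟨b, v, w, i, j, hbv, hbw, hij, rfl, rfl⟩⟩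
    obtain ⟨rfl, rfl | rfl⟩ := PP_inj_near (by omega) hbv hbw (by omega) (by omega) e
    · rw [PP_zero, PP_zero]
    · rfl

theorem chrom_step {V : Type*} {G : SimpleGraph V} (hG : ∀ u, ∃ v, G.Adj u v)
    {n m : ℕ} (hn : m < n) :
    (fracPower G m (n + (m + 1))).chromaticNumber ≤ (fracPower G m n).chromaticNumber := by
  classical
  let _ : LinearOrder V := WellOrderingRel.isWellOrder.linearOrder
  exact chromaticNumber_mono_of_hom ⟨cutMap G n m, fun h => cut_adj hG hn h⟩

theorem finite_vert {V : Type*} [Finite V] (G : SimpleGraph V) (n : ℕ) :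
    Finite (SubdivVert G n) := by
  have : Finite (SubdivPre G n) := by
    apply Finite.of_injective
      (β := V × V × Fin (n + 1)) (fun p => (p.1.1, p.1.2.1, ⟨p.1.2.2, by have := p.2; omega⟩))
    rintro ⟨⟨a, b, c⟩, h⟩ ⟨⟨a', b', c'⟩, h'⟩ e
    simp only [Prod.mk.injEq, Fin.mk.injEq] at e
    obtain ⟨rfl, rfl, rfl⟩ := e
    rfl
  exact Quot.finite _

/-- Two points of a common edge which are close are close along that edge. -/
theorem close_same {V : Type*} {G : SimpleGraph V} {n m : ℕ} (hn : m < n) {u v : V} {i j : ℕ}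
    (h : G.Adj u v) (hi : i ≤ n) (hj : j ≤ n) (hc : Close G n m (PP G n u v i) (PP G n u v j)) :
    i ≤ j + m ∧ j ≤ i + m := by
  have := h.ne
  rcases hc with ⟨s, t, k, l, hst, hk, hl, h1, h2, e1, e2⟩ |
    ⟨b, s, t, k, l, hbs, hbt, hij, e1, e2⟩
  · have := hst.ne
    rcases PP_inj (by omega) h hst hi hk e1 with a | a | a | a | a | a <;>
    rcases PP_inj (by omega) h hst hj hl e2 with b | b | b | b | b | b <;> grind
  · have := hbs.ne
    have := hbt.ne
    rcases PP_inj (by omega) h hbs hi (by omega) e1 with a | a | a | a | a | a <;>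
    rcases PP_inj (by omega) h hbt hj (by omega) e2 with b | b | b | b | b | b <;> grind

/-- Two close points on different arms of a star. -/
theorem close_diff {V : Type*} {G : SimpleGraph V} {n m : ℕ} (hn : m < n) {b v w : V} {i j : ℕ}
    (h : G.Adj b v) (h' : G.Adj b w) (hvw : v ≠ w) (hi : i ≤ n) (hj : j ≤ n)
    (hi0 : i ≠ 0) (hj0 : j ≠ 0)
    (hc : Close G n m (PP G n b v i) (PP G n b w j)) : i + j ≤ m := by
  have := h.ne
  have := h'.ne
  rcases hc with ⟨s, t, k, l, hst, hk, hl, h1, h2, e1, e2⟩ |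
    ⟨b, s, t, k, l, hbs, hbt, hij, e1, e2⟩
  · have := hst.ne
    rcases PP_inj (by omega) h hst hi hk e1 with a | a | a | a | a | a <;>
    rcases PP_inj (by omega) h' hst hj hl e2 with b | b | b | b | b | b <;> grind
  · have := hbs.ne
    have := hbt.ne
    rcases PP_inj (by omega) h hbs hi (by omega) e1 with a | a | a | a | a | a <;>
    rcases PP_inj (by omega) h' hbt hj (by omega) e2 with b | b | b | b | b | b <;> grind

/-- `x` lies in the closed star of `b`. -/
def InStar {V : Type*} (G : SimpleGraph V) (n : ℕ) (b : V) (x : SubdivVert G n) : Prop :=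
  ∃ v i, G.Adj b v ∧ i ≤ n ∧ x = PP G n b v i

theorem star_of_three {V : Type*} {G : SimpleGraph V} {n m : ℕ} (hn : m < n) {u v w : V}
    {i j : ℕ} {y : SubdivVert G n} (huv : G.Adj u v) (huw : G.Adj u w) (hvw : v ≠ w)
    (hi : 0 < i) (hj : 0 < j) (hij : i + j ≤ m)
    (h1 : Close G n m (PP G n u v i) y) (h2 : Close G n m (PP G n u w j) y) :
    InStar G n u y := by
  -- closeness to an interior point of the edge `uv`
  have key : ∀ v i, G.Adj u v → 0 < i → i < n → Close G n m (PP G n u v i) y →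
      InStar G n u y ∨ ∃ t k, G.Adj v t ∧ y = PP G n v t k ∧ n - i + k ≤ m := by
    intro v i huv hi hin hc
    have := huv.ne
    rcases hc with ⟨s, t, k, l, hst, hk, hl, h1, h2, e1, e2⟩ |
      ⟨b, s, t, k, l, hbs, hbt, hij, e1, e2⟩
    · left
      rcases PP_inj (by omega) huv hst (by omega) hk e1 with a | a | a | a | a | a
      · obtain ⟨rfl, rfl, rfl⟩ := a
        exact ⟨v, l, huv, hl, e2⟩
      · obtain ⟨rfl, rfl, _⟩ := a
        exact ⟨v, n - l, huv, by omega, e2.trans (PP_flip hst (by omega))⟩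
      all_goals omega
    · rcases PP_inj (by omega) huv hbs (by omega) (by omega) e1 with a | a | a | a | a | a
      · obtain ⟨rfl, rfl, rfl⟩ := a
        exact Or.inl ⟨t, l, hbt, by omega, e2⟩
      · obtain ⟨rfl, rfl, _⟩ := a
        exact Or.inr ⟨t, l, hbt, e2, by omega⟩
      all_goals omega
  rcases key v i huv hi (by omega) h1 with h | ⟨t, k, hvt, e, hk⟩
  · exact h
  rcases key w j huw hj (by omega) h2 with h | ⟨t', k', hwt, e', hk'⟩
  · exact h
  have := huv.ne
  have := huw.ne
  have := hvt.ne
  have := hwt.ne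
  rcases PP_inj (by omega) hvt hwt (by omega) (by omega) (e.symm.trans e') with
    a | a | a | a | a | a <;> grind

theorem clique_star {V : Type*} [Nonempty V] {G : SimpleGraph V} (hG : ∀ u, ∃ v, G.Adj u v)
    {n m : ℕ} (hn : m < n) (K : Set (SubdivVert G n)) (hK : (fracPower G m n).IsClique K) :
    ∃ b, ∀ x ∈ K, InStar G n b x := by
  have hc : ∀ x ∈ K, ∀ y ∈ K, Close G n m x y := by
    intro x hx y hy
    by_cases e : x = y
    · subst e; exact close_refl hG _ _
    · exact ((frac_adj hG hn).1 (hK hx hy e)).2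
  by_cases hint : ∃ u v i, G.Adj u v ∧ 0 < i ∧ i < n ∧ PP G n u v i ∈ K
  · obtain ⟨u, v, i, huv, hi, hin, hx⟩ := hint
    by_cases hall : ∀ y ∈ K, ∃ j, j ≤ n ∧ y = PP G n u v j
    · refine ⟨u, fun y hy => ?_⟩
      obtain ⟨j, hj, e⟩ := hall y hy
      exact ⟨v, j, huv, hj, e⟩
    · push Not at hall
      obtain ⟨z, hz, hzn⟩ := hall
      rcases hc _ hx _ hz with ⟨s, t, k, l, hst, hk, hl, h1, h2, e1, e2⟩ |
        ⟨b, s, t, k, l, hbs, hbt, hij, e1, e2⟩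
      · exfalso
        rcases PP_inj (by omega) huv hst (by omega) hk e1 with a | a | a | a | a | a
        · obtain ⟨rfl, rfl, rfl⟩ := a
          exact hzn l hl e2
        · obtain ⟨rfl, rfl, _⟩ := a
          exact hzn (n - l) (by omega) (e2.trans (PP_flip hst (by omega)))
        all_goals omega
      · have hst : s ≠ t ∧ 0 < l := by
          rcases PP_inj (by omega) huv hbs (by omega) (by omega) e1 with a | a | a | a | a | a
          · obtain ⟨rfl, rfl, rfl⟩ := a
            constructor
            · rintro rfl
              exact hzn l (by omega) e2
            · by_contra h0
              obtain rfl : l = 0 := by omega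
              exact hzn 0 (by omega) (by rw [e2, PP_zero, PP_zero])
          · obtain ⟨rfl, rfl, _⟩ := a
            constructor
            · rintro rfl
              exact hzn (n - l) (by omega) (e2.trans (PP_flip hbs (by omega)))
            · by_contra h0
              obtain rfl : l = 0 := by omega
              exact hzn n (by omega) (by rw [e2, PP_zero, PP_end huv])
          all_goals omega
        have hk0 : 0 < k := by
          rcases PP_inj (by omega) huv hbs (by omega) (by omega) e1 with a | a | a | a | a | a <;>
            omega
        rw [e1] at hx
        rw [e2] at hz
        exact ⟨b, fun y hy => star_of_three hn hbs hbt hst.1 hk0 hst.2 hij (hc _ hx _ hy)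
          (hc _ hz _ hy)⟩
  · push Not at hint
    by_cases hne : K.Nonempty
    · obtain ⟨x, hx⟩ := hne
      have hbr : ∀ y ∈ K, ∃ b, y = branchVertex G n b := by
        intro y hy
        obtain ⟨u, v, i, h, hi, rfl⟩ := PP_surj hG y
        by_cases h0 : i = 0
        · subst h0; exact ⟨u, PP_zero⟩
        · by_cases h1 : i = n
          · subst h1; exact ⟨v, PP_end h⟩
          · exact absurd hy (hint u v i h (by omega) (by omega))
      obtain ⟨b, rfl⟩ := hbr x hx
      refine ⟨b, fun y hy => ?_⟩
      obtain ⟨b', rfl⟩ := hbr y hy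
      obtain ⟨w, hw⟩ := hG b
      obtain ⟨w', hw'⟩ := hG b'
      have hcl := hc _ hx _ hy
      rw [← PP_zero (v := w), ← PP_zero (v := w')] at hcl
      rcases hcl with ⟨s, t, k, l, hst, hk, hl, h1, h2, e1, e2⟩ |
        ⟨c, s, t, k, l, hbs, hbt, hij, e1, e2⟩
      · rcases PP_inj (by omega) hw hst (by omega) hk e1 with a | a | a | a | a | a
        · obtain ⟨rfl, rfl, rfl⟩ := a
          exact ⟨w, l, hw, hl, by rw [← e2, PP_zero]⟩
        · obtain ⟨rfl, rfl, _⟩ := a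
          exact ⟨w, n - l, hw, by omega, by
            rw [← PP_flip hst (i := l) (by omega), ← e2, PP_zero]⟩
        · obtain ⟨_, rfl, rfl⟩ := a
          exact ⟨t, l, hst, hl, by rw [← e2, PP_zero]⟩
        · obtain ⟨_, rfl, rfl⟩ := a
          exact ⟨s, k - l, hst.symm, by omega, by
            rw [← PP_flip hst (i := l) (by omega), ← e2, PP_zero]⟩
        all_goals omega
      · refine ⟨w, 0, hw, by omega, ?_⟩
        have := hw.ne
        have := hw'.ne
        have := hbs.ne
        have := hbt.ne
        rw [PP_zero]
        congr 1
        rcases PP_inj (by omega) hw hbs (by omega) (by omega) e1 with a | a | a | a | a | a <;>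
        rcases PP_inj (by omega) hw' hbt (by omega) (by omega) e2 with b | b | b | b | b | b <;>
        grind
    · refine ⟨Classical.arbitrary V, fun x hx => ?_⟩
      exact absurd ⟨x, hx⟩ hne

theorem clique_step {V : Type*} [Finite V] [Nonempty V] {G : SimpleGraph V}
    (hG : ∀ u, ∃ v, G.Adj u v) {n n' m : ℕ} (hn : m < n) (hn' : n < n') :
    (fracPower G m n).cliqueNum ≤ (fracPower G m n').cliqueNum := by
  classical
  have := finite_vert G n
  have := finite_vert G n'
  obtain ⟨K, hK, hKc⟩ := (fracPower G m n).exists_isNClique_cliqueNum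
  obtain ⟨b, hb⟩ := clique_star hG hn _ hK
  have hb' : ∀ x, ∃ p : V × ℕ, x ∈ K → G.Adj b p.1 ∧ p.2 ≤ n ∧ x = PP G n b p.1 p.2 := by
    intro x
    by_cases hx : x ∈ K
    · obtain ⟨v, i, h1, h2, h3⟩ := hb x (by simpa using hx)
      exact ⟨(v, i), fun _ => ⟨h1, h2, h3⟩⟩
    · exact ⟨(b, 0), fun h => absurd h hx⟩
  choose p hp using hb'
  have hadj : ∀ x ∈ K, ∀ y ∈ K, x ≠ y → (fracPower G m n').Adj
      (PP G n' b (p x).1 (p x).2) (PP G n' b (p y).1 (p y).2) := by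
    intro x hx y hy hne
    have hcl := ((frac_adj hG hn).1 (hK (by simpa using hx) (by simpa using hy) hne)).2
    obtain ⟨h1, h2, h3⟩ := hp x hx
    obtain ⟨h4, h5, h6⟩ := hp y hy
    rw [frac_adj hG (by omega)]
    generalize p x = px at *
    generalize p y = py at *
    obtain ⟨v, i⟩ := px
    obtain ⟨w, j⟩ := py
    simp only at *
    refine ⟨fun e => hne ?_, ?_⟩
    · obtain ⟨rfl, rfl | rfl⟩ := PP_inj_near (by omega) h1 h4 (by omega) (by omega) e
      · rw [h3, h6, PP_zero, PP_zero]
      · rw [h3, h6]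
    · rw [h3, h6] at hcl
      by_cases hvw : v = w
      · subst hvw
        have := close_same hn h1 h2 h5 hcl
        exact Or.inl ⟨b, v, i, j, h1, by omega, by omega, this.1, this.2, rfl, rfl⟩
      · by_cases hi : i = 0
        · subst hi
          rw [PP_zero, ← PP_zero (v := w)] at hcl
          have := close_same hn h4 h2 h5 hcl
          exact Or.inr ⟨b, v, w, 0, j, h1, h4, by omega, rfl, rfl⟩
        · by_cases hj : j = 0
          · subst hj
            rw [PP_zero (v := w), ← PP_zero (v := v)] at hcl
            have := close_same hn h1 h2 h5 hcl
            exact Or.inr ⟨b, v, w, i, 0, h1, h4, by omega, rfl, rfl⟩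
          · have := close_diff hn h1 h4 hvw h2 h5 hi hj hcl
            exact Or.inr ⟨b, v, w, i, j, h1, h4, by omega, rfl, rfl⟩
  rw [← hKc, ← Finset.card_image_of_injOn (s := K)
    (f := fun x => PP G n' b (p x).1 (p x).2) ?_]
  · apply IsClique.card_le_cliqueNum
    intro x hx y hy hne
    simp only [Finset.coe_image, Set.mem_image, Finset.mem_coe] at hx hy
    obtain ⟨x, hx, rfl⟩ := hx
    obtain ⟨y, hy, rfl⟩ := hy
    exact hadj x hx y hy (by rintro rfl; exact hne rfl)
  · intro x hx y hy e
    by_contra hne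
    exact (hadj x (by simpa using hx) y (by simpa using hy) hne).ne e

theorem bool_toNat_inj {a b : Bool} (h : a.toNat = b.toNat) : a = b := by
  cases a <;> cases b <;> simp_all

/-- Two fixed-point-free involutions admit a common 2-colouring. -/
theorem invol_color {X : Type*} (σ τ : X → X) (hσ : ∀ x, σ (σ x) = x) (hτ : ∀ x, τ (τ x) = x)
    (hσ' : ∀ x, σ x ≠ x) (hτ' : ∀ x, τ x ≠ x) :
    ∃ c : X → Bool, (∀ x, c (σ x) ≠ c x) ∧ (∀ x, c (τ x) ≠ c x) := by
  classical
  let s : Equiv.Perm X := ⟨σ, σ, hσ, hσ⟩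
  let t : Equiv.Perm X := ⟨τ, τ, hτ, hτ⟩
  have hs : s * s = 1 := by ext x; exact hσ x
  have ht : t * t = 1 := by ext x; exact hτ x
  let ρ : Equiv.Perm X := t * s
  have hs1 : s⁻¹ = s := inv_eq_of_mul_eq_one_left hs
  have ht1 : t⁻¹ = t := inv_eq_of_mul_eq_one_left ht
  have hconj : ∀ j : ℤ, s * ρ ^ j = ρ ^ (-j) * s := by
    intro j
    have h1 : s * ρ * s⁻¹ = ρ⁻¹ := by
      simp only [ρ, mul_inv_rev, hs1, ht1]
      rw [mul_assoc, mul_assoc, hs, mul_one]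
    have h2 : s * ρ ^ j * s⁻¹ = ρ ^ (-j) := by
      rw [← conj_zpow, h1, inv_zpow, zpow_neg]
    rw [← h2]; simp
  have hdiff : ∀ x, ¬ ρ.SameCycle x (s x) := by
    rintro x ⟨k, hk⟩
    rcases Int.even_or_odd' k with ⟨j, rfl | rfl⟩
    · apply hσ' ((ρ ^ j) x)
      change s ((ρ ^ j) x) = _
      rw [← Equiv.Perm.mul_apply, hconj, Equiv.Perm.mul_apply, ← hk, ← Equiv.Perm.mul_apply,
        ← zpow_add]
      congr 2; ring
    · apply hτ' ((ρ ^ (j + 1)) x)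
      have e : t * ρ ^ (j + 1) = s * ρ ^ j := by
        have : t * ρ = s := by simp only [ρ]; rw [← mul_assoc, ht, one_mul]
        rw [add_comm, zpow_add, zpow_one, ← mul_assoc, this]
      change t ((ρ ^ (j + 1)) x) = _
      rw [← Equiv.Perm.mul_apply, e, hconj, Equiv.Perm.mul_apply, ← hk, ← Equiv.Perm.mul_apply,
        ← zpow_add]
      congr 2; ring
  let Q := Quotient (Equiv.Perm.SameCycle.setoid ρ)
  let _ : LinearOrder Q := WellOrderingRel.isWellOrder.linearOrder
  let q : X → Q := fun x => Quotient.mk _ x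
  have hq : ∀ x, q x ≠ q (s x) := fun x e => hdiff x (Quotient.exact e)
  have h1 : ∀ x, q (t x) = q (s x) := by
    intro x
    refine (Quotient.sound (s := Equiv.Perm.SameCycle.setoid ρ) (?_ : ρ.SameCycle _ _)).symm
    refine ⟨1, ?_⟩
    simp only [zpow_one, ρ, Equiv.Perm.mul_apply]
    rw [← Equiv.Perm.mul_apply s s, hs]; rfl
  have h2 : ∀ x, q (s (t x)) = q x := by
    intro x
    refine (Quotient.sound (s := Equiv.Perm.SameCycle.setoid ρ) (?_ : ρ.SameCycle _ _))
    refine ⟨1, ?_⟩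
    simp only [zpow_one, ρ, Equiv.Perm.mul_apply]
    rw [← Equiv.Perm.mul_apply s s, hs, Equiv.Perm.one_apply, ← Equiv.Perm.mul_apply, ht]; rfl
  have h3 : ∀ x, q (s (s x)) = q x := fun x => congrArg q (hσ x)
  refine ⟨fun x => decide (q x < q (s x)), fun x => ?_, fun x => ?_⟩
  · change decide (q (s x) < q (s (s x))) ≠ _
    rw [h3]
    intro e
    rw [decide_eq_decide] at e
    rcases lt_or_gt_of_ne (hq x) with h | h
    · exact (e.2 h).not_gt h
    · exact (e.1 h).not_gt h
  · change decide (q (t x) < q (s (t x))) ≠ _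
    rw [h1, h2]
    intro e
    rw [decide_eq_decide] at e
    rcases lt_or_gt_of_ne (hq x) with h | h
    · exact (e.2 h).not_gt h
    · exact (e.1 h).not_gt h

theorem invol_color' {X : Type*} (σ τ : X → X) (hσ : ∀ x, σ (σ x) = x) (hτ : ∀ x, τ (τ x) = x) :
    ∃ c : X → Bool, (∀ x, σ x ≠ x → c (σ x) ≠ c x) ∧ (∀ x, τ x ≠ x → c (τ x) ≠ c x) := by
  classical
  let L : (X → X) → X × Bool → X × Bool := fun f p => if f p.1 = p.1 then (p.1, !p.2) else (f p.1, p.2)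
  have hL : ∀ f : X → X, (∀ x, f (f x) = x) → (∀ p, L f (L f p) = p) ∧ ∀ p, L f p ≠ p := by
    intro f hf
    constructor
    · rintro ⟨x, b⟩
      by_cases h : f x = x
      · simp [L, h]
      · have : f (f x) ≠ f x := by rw [hf]; exact fun e => h e.symm
        simp [L, h, hf]
        intro e; exact absurd e.symm h
    · rintro ⟨x, b⟩
      by_cases h : f x = x
      · simp [L, h]
      · simp [L, h]
  obtain ⟨c, h1, h2⟩ := invol_color (L σ) (L τ) (hL σ hσ).1 (hL τ hτ).1 (hL σ hσ).2 (hL τ hτ).2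
  refine ⟨fun x => c (x, false), fun x hx => ?_, fun x hx => ?_⟩
  · have := h1 (x, false)
    simpa [L, hx] using this
  · have := h2 (x, false)
    simpa [L, hx] using this

theorem dart_label_two {V : Type*} [DecidableEq V] (X : Finset (V × V)) (hX : ∀ p ∈ X, p.1 ≠ p.2)
    (hdeg : ∀ u, (X.filter (fun p => p.1 = u)).card ≤ 2) :
    ∃ l : V × V → ℕ, (∀ p, l p < 2) ∧ (∀ p ∈ X, ∀ q ∈ X, p.1 = q.1 → p ≠ q → l p ≠ l q) ∧
      (∀ p ∈ X, p.swap ∈ X → l p ≠ l p.swap) := by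
  classical
  have huniq : ∀ p ∈ X, ∀ q ∈ X, ∀ r ∈ X, p.1 = q.1 → p.1 = r.1 → p ≠ q → p ≠ r → q = r := by
    intro p hp q hq r hr h1 h2 h3 h4
    by_contra h5
    have : ({p, q, r} : Finset (V × V)) ⊆ X.filter (fun x => x.1 = p.1) := by
      intro x hx
      simp only [Finset.mem_insert, Finset.mem_singleton] at hx
      rw [Finset.mem_filter]
      rcases hx with rfl | rfl | rfl
      · exact ⟨hp, rfl⟩
      · exact ⟨hq, h1.symm⟩
      · exact ⟨hr, h2.symm⟩
    have h6 := Finset.card_le_card this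
    rw [Finset.card_eq_three.2 ⟨p, q, r, h3, h4, h5, rfl⟩] at h6
    have := hdeg p.1
    omega
  let P : V × V → V × V → Prop := fun p q => p ∈ X ∧ q ∈ X ∧ p.1 = q.1 ∧ p ≠ q
  let σ : V × V → V × V := fun p => if h : ∃ q, P p q then h.choose else p
  have hσP : ∀ p q, P p q → σ p = q := by
    intro p q h
    have h' : ∃ q, P p q := ⟨q, h⟩
    have e : σ p = h'.choose := dif_pos h'
    have s := h'.choose_spec
    rw [e]
    exact huniq p h.1 _ s.2.1 _ h.2.1 s.2.2.1 h.2.2.1 s.2.2.2 h.2.2.2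
  have hσ : ∀ p, σ (σ p) = p := by
    intro p
    by_cases h : ∃ q, P p q
    · obtain ⟨q, h⟩ := h
      rw [hσP p q h]
      exact hσP q p ⟨h.2.1, h.1, h.2.2.1.symm, h.2.2.2.symm⟩
    · have e : σ p = p := dif_neg h
      rw [e, e]
  let τ : V × V → V × V := fun p => if p ∈ X ∧ p.swap ∈ X then p.swap else p
  have hτ : ∀ p, τ (τ p) = p := by
    intro p
    by_cases h : p ∈ X ∧ p.swap ∈ X
    · have e : τ p = p.swap := if_pos h
      rw [e]
      have h' : p.swap ∈ X ∧ p.swap.swap ∈ X := ⟨h.2, by simpa using h.1⟩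
      have e' : τ p.swap = p.swap.swap := if_pos h'
      rw [e', Prod.swap_swap]
    · have e : τ p = p := if_neg h
      rw [e, e]
  obtain ⟨c, h1, h2⟩ := invol_color' σ τ hσ hτ
  refine ⟨fun p => (c p).toNat, fun p => Bool.toNat_lt _, ?_, ?_⟩
  · intro p hp q hq e hne h
    have h3 := hσP p q ⟨hp, hq, e, hne⟩
    have h4 := h1 p (by rw [h3]; exact hne.symm)
    rw [h3] at h4
    exact h4 (bool_toNat_inj h.symm)
  · intro p hp hq h
    have h3 : τ p = p.swap := if_pos ⟨hp, hq⟩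
    have h4 := h2 p (by
      rw [h3]; intro e
      exact hX p hp (congrArg Prod.snd e))
    rw [h3] at h4
    exact h4 (bool_toNat_inj h.symm)

/-- A matching saturating the vertices of maximum degree. -/
theorem dart_matching {V : Type*} [Fintype V] [DecidableEq V] (X : Finset (V × V)) (k : ℕ)
    (hk : 2 ≤ k) : ∃ M ⊆ X, (∀ p ∈ M, ∀ q ∈ M, p.1 = q.1 → p = q) ∧
      (∀ p ∈ M, p.swap ∈ M → p.swap = p) ∧
      ∀ u, (X.filter (fun p => p.1 = u)).card = k → ∃ p ∈ M, p.1 = u := by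
  classical
  let ι := {u : V // (X.filter (fun p => p.1 = u)).card = k}
  let t : ι → Finset (Sym2 V) := fun u => (X.filter (fun p => p.1 = u.1)).image (fun p => s(p.1, p.2))
  have htc : ∀ u, (t u).card = k := by
    intro u
    rw [← u.2]
    apply Finset.card_image_of_injOn
    rintro ⟨a, b⟩ ha ⟨c, d⟩ hc e
    simp only [Finset.coe_filter, Set.mem_ofPred_eq] at ha hc
    simp only at e
    obtain ⟨_, rfl⟩ := ha
    obtain ⟨_, rfl⟩ := hc
    rw [Sym2.congr_right] at e
    rw [e]
  have hall : ∀ S : Finset ι, S.card ≤ (S.biUnion t).card := by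
    intro S
    have := Finset.card_mul_le_card_mul (s := S) (t := S.biUnion t) (fun u e => e ∈ t u)
      (m := k) (n := 2) ?_ ?_
    · nlinarith
    · intro u hu
      rw [← htc u]
      apply Finset.card_le_card
      intro e he
      rw [Finset.mem_bipartiteAbove]
      exact ⟨Finset.mem_biUnion.2 ⟨u, hu, he⟩, he⟩
    · intro e _
      induction e using Sym2.ind with
      | _ a b =>
      have : ((S.bipartiteBelow (fun u e => e ∈ t u) s(a, b)).image Subtype.val) ⊆ {a, b} := by
        intro x hx
        rw [Finset.mem_image] at hx
        obtain ⟨u, hu, rfl⟩ := hx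
        rw [Finset.mem_bipartiteBelow] at hu
        obtain ⟨_, hu⟩ := hu
        simp only [t, Finset.mem_image, Finset.mem_filter] at hu
        obtain ⟨p, ⟨_, hp⟩, e⟩ := hu
        rw [← hp]
        rw [Sym2.eq_iff] at e
        simp only [Finset.mem_insert, Finset.mem_singleton]
        tauto
      have h2 := Finset.card_le_card this
      rw [Finset.card_image_of_injective _ Subtype.val_injective] at h2
      exact h2.trans Finset.card_le_two
  obtain ⟨f, hf, hft⟩ := (Finset.all_card_le_biUnion_card_iff_exists_injective t).1 hall
  have hg : ∀ u : ι, ∃ p ∈ X, p.1 = u.1 ∧ s(p.1, p.2) = f u := by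
    intro u
    have := hft u
    simp only [t, Finset.mem_image, Finset.mem_filter] at this
    obtain ⟨p, ⟨h1, h2⟩, h3⟩ := this
    exact ⟨p, h1, h2, h3⟩
  choose g hgX hg1 hgf using hg
  refine ⟨Finset.univ.image g, ?_, ?_, ?_, ?_⟩
  · intro p hp
    simp only [Finset.mem_image, Finset.mem_univ, true_and] at hp
    obtain ⟨u, rfl⟩ := hp
    exact hgX u
  · intro p hp q hq e
    simp only [Finset.mem_image, Finset.mem_univ, true_and] at hp hq
    obtain ⟨u, rfl⟩ := hp
    obtain ⟨v, rfl⟩ := hq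
    rw [hg1, hg1] at e
    rw [Subtype.ext e]
  · intro p hp hq
    simp only [Finset.mem_image, Finset.mem_univ, true_and] at hp hq
    obtain ⟨u, rfl⟩ := hp
    obtain ⟨v, e⟩ := hq
    have : f v = f u := by
      rw [← hgf, ← hgf, e]
      exact Sym2.eq_swap
    rw [← e, hf this]
  · intro u hu
    exact ⟨g ⟨u, hu⟩, by simp, hg1 _⟩

theorem dart_label {V : Type*} [Fintype V] [DecidableEq V] (k : ℕ) (hk : 2 ≤ k) :
    ∀ (X : Finset (V × V)), (∀ p ∈ X, p.1 ≠ p.2) →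
    (∀ u, (X.filter (fun p => p.1 = u)).card ≤ k) →
    ∃ l : V × V → ℕ, (∀ p, l p < k) ∧ (∀ p ∈ X, ∀ q ∈ X, p.1 = q.1 → p ≠ q → l p ≠ l q) ∧
      (∀ p ∈ X, p.swap ∈ X → l p ≠ l p.swap) := by
  induction k, hk using Nat.le_induction with
  | base => exact dart_label_two
  | succ k hk ih =>
    intro X hX hdeg
    obtain ⟨M, hMX, hM1, hM2, hM3⟩ := dart_matching X (k + 1) (by omega)
    obtain ⟨l, hl1, hl2, hl3⟩ := ih (X \ M) (fun p hp => hX p (Finset.sdiff_subset hp)) (by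
      intro u
      by_cases h : (X.filter (fun p => p.1 = u)).card = k + 1
      · obtain ⟨p, hp, hpu⟩ := hM3 u h
        have : ((X \ M).filter (fun p => p.1 = u)) ⊂ X.filter (fun p => p.1 = u) := by
          rw [Finset.ssubset_iff_of_subset (Finset.filter_subset_filter _ Finset.sdiff_subset)]
          refine ⟨p, ?_, ?_⟩
          · simp [hMX hp, hpu]
          · simp [hp]
        have := Finset.card_lt_card this
        omega
      · have h2 := Finset.card_le_card (Finset.filter_subset_filter (fun p => p.1 = u)
          (Finset.sdiff_subset (s := X) (t := M)))
        have := hdeg u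
        omega)
    refine ⟨fun p => if p ∈ M then k else l p, ?_, ?_, ?_⟩
    · intro p
      have := hl1 p
      simp only
      split_ifs <;> omega
    · intro p hp q hq e hne
      have a1 := hl1 p
      have a2 := hl1 q
      simp only
      split_ifs with h1 h2 h2
      · exact absurd (hM1 p h1 q h2 e) hne
      · omega
      · omega
      · exact hl2 p (by simp [*]) q (by simp [*]) e hne
    · intro p hp hq
      have a1 := hl1 p
      have a2 := hl1 p.swap
      simp only
      split_ifs with h1 h2 h2
      · exact absurd (congrArg Prod.snd (hM2 p h1 h2)) (hX p hp)
      · omega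
      · omega
      · exact hl3 p (by simp [hp, h1]) (by rw [Finset.mem_sdiff]; exact ⟨hq, h2⟩)

theorem graph_label {V : Type*} [Fintype V] (G : SimpleGraph V) [DecidableRel G.Adj]
    (hΔ : 2 ≤ G.maxDegree) : ∃ l : V → V → ℕ, (∀ u v, l u v < G.maxDegree) ∧
      (∀ u v w, G.Adj u v → G.Adj u w → v ≠ w → l u v ≠ l u w) ∧
      (∀ u v, G.Adj u v → l u v ≠ l v u) := by
  classical
  obtain ⟨l, h1, h2, h3⟩ := dart_label G.maxDegree hΔ
    (Finset.univ.filter (fun p : V × V => G.Adj p.1 p.2)) (by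
      intro p hp
      exact (Finset.mem_filter.1 hp).2.ne) (by
      intro u
      refine le_trans ?_ (G.degree_le_maxDegree u)
      rw [← G.card_neighborFinset_eq_degree u]
      apply Finset.card_le_card_of_injOn Prod.snd
      · intro p hp
        simp only [Finset.coe_filter, Finset.mem_filter, Finset.mem_univ, true_and,
          Set.mem_ofPred_eq] at hp
        obtain ⟨hp, rfl⟩ := hp
        simpa using hp
      · rintro ⟨a, b⟩ ha ⟨c, d⟩ hc e
        simp only [Finset.coe_filter, Finset.mem_filter, Finset.mem_univ, true_and,
          Set.mem_ofPred_eq] at ha hc e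
        simp [ha.2, hc.2, e])
  refine ⟨fun u v => l (u, v), fun u v => h1 _, fun u v w huv huw hne => ?_, fun u v huv => ?_⟩
  · exact h2 (u, v) (by simpa using huv) (u, w) (by simpa using huw) rfl (by simpa using hne)
  · exact h3 (u, v) (by simpa using huv) (by simpa using huv.symm)

/-- The colour of the point at position `i` of the edge `uv`. -/
def colVal {V : Type*} (l : V → V → ℕ) (n : ℕ) (u v : V) (i : ℕ) : ℕ × ℕ :=
  if i = 0 ∨ i = n ∨ 2 * i = n then (0, min i (n - i))
  else if 2 * i < n then (l u v, i) else (l v u, n - i)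

theorem colVal_rel {V : Type*} (G : SimpleGraph V) (l : V → V → ℕ) (n : ℕ)
    (p q : SubdivPre G n) (h : SubdivRel G n p q) :
    colVal l n p.1.1 p.1.2.1 p.1.2.2 = colVal l n q.1.1 q.1.2.1 q.1.2.2 := by
  cases h with
  | flip u v i h hi =>
    simp only [colVal]
    split_ifs <;> first | omega | (simp only [Prod.mk.injEq, true_and] <;> omega)
  | collapse u v h => simp [colVal]

/-- The colouring of `G^{m/(m+1)}`. -/
def colMap {V : Type*} (G : SimpleGraph V) (l : V → V → ℕ) (n : ℕ) : SubdivVert G n → ℕ × ℕ :=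
  Quot.lift (fun p => colVal l n p.1.1 p.1.2.1 p.1.2.2) (colVal_rel G l n)

theorem colMap_PP {V : Type*} {G : SimpleGraph V} {l : V → V → ℕ} {n : ℕ} {u v : V} {i : ℕ}
    (h : G.Adj u v) (hi : i ≤ n) : colMap G l n (PP G n u v i) = colVal l n u v i := by
  rw [← PP_eq h hi]; rfl

/-- The set of colours. -/
def colSet (Δ n : ℕ) : Finset (ℕ × ℕ) :=
  (Finset.range Δ ×ˢ Finset.range (n + 1)).filter
    (fun p => 2 * p.2 ≤ n ∧ ((p.2 = 0 ∨ 2 * p.2 = n) → p.1 = 0))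

theorem chrom_base {V : Type*} [Fintype V] (G : SimpleGraph V) [DecidableRel G.Adj]
    (hG : ∀ u, ∃ v, G.Adj u v) (hΔ : 2 ≤ G.maxDegree) (m : ℕ) :
    (fracPower G m (m + 1)).chromaticNumber ≤ ((colSet G.maxDegree (m + 1)).card : ℕ∞) := by
  obtain ⟨l, h1, h2, h3⟩ := graph_label G hΔ
  have hmem : ∀ x, colMap G l (m + 1) x ∈ colSet G.maxDegree (m + 1) := by
    intro x
    obtain ⟨u, v, i, h, hi, rfl⟩ := PP_surj hG x
    rw [colMap_PP h hi]
    have := h1 u v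
    have := h1 v u
    simp only [colSet, colVal, Finset.mem_filter, Finset.mem_product, Finset.mem_range]
    split_ifs <;> simp only <;> refine ⟨⟨?_, ?_⟩, ?_, ?_⟩ <;> intros <;> first | trivial | omega
  have hproper : ∀ x y, (fracPower G m (m + 1)).Adj x y →
      colMap G l (m + 1) x ≠ colMap G l (m + 1) y := by
    intro x y hxy
    rw [frac_adj hG (by omega)] at hxy
    obtain ⟨hne, ⟨u, v, i, j, huv, hi, hj, hij1, hij2, rfl, rfl⟩ |
      ⟨b, v, w, i, j, hbv, hbw, hij, rfl, rfl⟩⟩ := hxy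
    · have hij : i ≠ j := by rintro rfl; exact hne rfl
      rw [colMap_PP huv hi, colMap_PP huv hj]
      have := h3 u v huv
      simp only [colVal]
      split_ifs <;> rw [ne_eq, Prod.mk.injEq] <;> rintro ⟨_, _⟩ <;> omega
    · rw [colMap_PP hbv (by omega), colMap_PP hbw (by omega)]
      have hvw : ¬ (i = 0 ∧ j = 0) := by
        rintro ⟨rfl, rfl⟩
        exact hne (by rw [PP_zero, PP_zero])
      by_cases e : v = w
      · subst e
        have hij' : i ≠ j := by rintro rfl; exact hne rfl
        have := h3 b v hbv
        simp only [colVal]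
        split_ifs <;> rw [ne_eq, Prod.mk.injEq] <;> rintro ⟨_, _⟩ <;> omega
      · have := h2 b v w hbv hbw e
        simp only [colVal]
        split_ifs <;> rw [ne_eq, Prod.mk.injEq] <;> rintro ⟨_, _⟩ <;> omega
  let C : (fracPower G m (m + 1)).Coloring (colSet G.maxDegree (m + 1)) :=
    Coloring.mk (fun x => ⟨colMap G l (m + 1) x, hmem x⟩) (by
      intro x y hxy e
      exact hproper x y hxy (congrArg Subtype.val e))
  have := C.colorable.chromaticNumber_le
  simpa using this

theorem clique_base {V : Type*} [Fintype V] [Nonempty V] (G : SimpleGraph V) [DecidableRel G.Adj]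
    (hG : ∀ u, ∃ v, G.Adj u v) (m : ℕ) :
    (colSet G.maxDegree (m + 1)).card ≤ (fracPower G m (m + 1)).cliqueNum := by
  classical
  have := finite_vert G (m + 1)
  obtain ⟨b, hb⟩ := G.exists_maximal_degree_vertex
  have hcard : (G.neighborFinset b).card = G.maxDegree := by
    rw [hb, card_neighborFinset_eq_degree]
  let e := (G.neighborFinset b).equivFinOfCardEq hcard
  have hf : ∃ f : ℕ → V, (∀ a < G.maxDegree, G.Adj b (f a)) ∧
      ∀ a < G.maxDegree, ∀ a' < G.maxDegree, f a = f a' → a = a' := by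
    refine ⟨fun a => if h : a < G.maxDegree then (e.symm ⟨a, h⟩).1 else b, ?_, ?_⟩
    · intro a ha
      have := (e.symm ⟨a, ha⟩).2
      simp only [ha, dif_pos]
      exact (G.mem_neighborFinset b _).1 this
    · intro a ha a' ha' h
      simp only [ha, ha', dif_pos] at h
      have := e.symm.injective (Subtype.ext h)
      simpa using this
  obtain ⟨f, hf1, hf2⟩ := hf
  have hadj : ∀ p ∈ colSet G.maxDegree (m + 1), ∀ q ∈ colSet G.maxDegree (m + 1), p ≠ q →
      (fracPower G m (m + 1)).Adj (PP G _ b (f p.1) p.2) (PP G _ b (f q.1) q.2) := by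
    rintro ⟨a, i⟩ hp ⟨c, j⟩ hq hne
    simp only [colSet, Finset.mem_filter, Finset.mem_product, Finset.mem_range] at hp hq
    simp only [ne_eq, Prod.mk.injEq, not_and] at hne
    have hij : i + j ≤ m := by omega
    rw [frac_adj hG (by omega)]
    refine ⟨fun h => ?_, Or.inr ⟨b, _, _, i, j, hf1 _ hp.1.1, hf1 _ hq.1.1, hij, rfl, rfl⟩⟩
    obtain ⟨rfl, h | h⟩ := PP_inj_near (by omega) (hf1 _ hp.1.1) (hf1 _ hq.1.1) (by omega)
      (by omega) h
    · omega
    · exact hne (hf2 _ hp.1.1 _ hq.1.1 h) rfl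
  rw [← Finset.card_image_of_injOn (s := colSet G.maxDegree (m + 1))
    (f := fun p => PP G (m + 1) b (f p.1) p.2) ?_]
  · apply IsClique.card_le_cliqueNum
    intro x hx y hy hne
    simp only [Finset.coe_image, Set.mem_image, Finset.mem_coe] at hx hy
    obtain ⟨x, hx, rfl⟩ := hx
    obtain ⟨y, hy, rfl⟩ := hy
    exact hadj x hx y hy (by rintro rfl; exact hne rfl)
  · intro x hx y hy e
    by_contra hne
    exact (hadj x (by simpa using hx) y (by simpa using hy) hne).ne e

theorem chromatic_le_clique_add_of_range {V : Type*} [Fintype V] (G : SimpleGraph V)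
    [DecidableRel G.Adj] (hconn : G.Connected) (hΔ : 3 ≤ G.maxDegree) (m c : ℕ) (hm : 0 < m)
    (h : ∀ n : ℕ, m + 2 ≤ n → n ≤ 2 * m + 1 →
      (fracPower G m n).chromaticNumber ≤ (((fracPower G m n).cliqueNum + c : ℕ) : ℕ∞)) :
    ∀ n : ℕ, m < n →
      (fracPower G m n).chromaticNumber ≤ (((fracPower G m n).cliqueNum + c : ℕ) : ℕ∞) := by
  have : Nonempty V := hconn.nonempty
  have : Nontrivial V := by
    by_contra hnt
    rw [not_nontrivial_iff_subsingleton] at hnt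
    obtain ⟨b, hb⟩ := G.exists_maximal_degree_vertex
    have h1 := G.degree_lt_card_verts b
    have h2 := Fintype.card_le_one_iff_subsingleton.2 hnt
    omega
  have hG : ∀ u, ∃ v, G.Adj u v := fun u => hconn.preconnected.exists_adj_of_nontrivial u
  intro n
  induction n using Nat.strong_induction_on with
  | _ n ih =>
  intro hn
  rcases Nat.lt_or_ge (2 * m + 1) n with h1 | h1
  · obtain ⟨n', rfl⟩ : ∃ n', n = n' + (m + 1) := ⟨n - (m + 1), by omega⟩
    refine (chrom_step hG (by omega)).trans ((ih n' (by omega) (by omega)).trans ?_)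
    have := clique_step hG (m := m) (n := n') (n' := n' + (m + 1)) (by omega) (by omega)
    exact_mod_cast Nat.add_le_add_right this c
  · rcases Nat.lt_or_ge n (m + 2) with h2 | h2
    · obtain rfl : n = m + 1 := by omega
      refine (chrom_base G hG (by omega) m).trans ?_
      have := clique_base G hG m
      exact_mod_cast this.trans (Nat.le_add_right _ c)
    · exact h n h2 h1
end

section
/- If G is a connected finite simple graph with maximum degree Δ ≥ 3, then there exists a proper vertex coloring h : V(G^{2/3}) → {0, 1, …, Δ} such that a vertex receives color 0 if and only if it is a branch vertex. -/
open SimpleGraph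

namespace G23

/-- Hall step: choose colors for the darts leaving `v`, avoiding `f`. -/
theorem hall_step {V : Type*} [Fintype V] (G : SimpleGraph V) [DecidableRel G.Adj] (Δ : ℕ)
    (v : V) (hd : G.degree v ≤ Δ) (f : V → ℕ)
    (hf : ∀ a ∈ Finset.Icc 1 Δ, G.degree v = Δ → ∃ u, G.Adj v u ∧ f u ≠ a) :
    ∃ g : V → ℕ, (∀ u, G.Adj v u → g u ∈ Finset.Icc 1 Δ ∧ g u ≠ f u) ∧
      (∀ u w, G.Adj v u → G.Adj v w → g u = g w → u = w) := by
  classical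
  let t : {u // u ∈ G.neighborFinset v} → Finset ℕ := fun u => (Finset.Icc 1 Δ).erase (f u)
  have key : ∀ S : Finset {u // u ∈ G.neighborFinset v}, S.card ≤ (S.biUnion t).card := by
    intro S
    rcases S.eq_empty_or_nonempty with rfl | ⟨u, hu⟩
    · simp
    have hcard : S.card ≤ G.degree v := by
      have := Finset.card_le_univ S
      rwa [Fintype.card_coe, SimpleGraph.card_neighborFinset_eq_degree] at this
    have h1 : Δ - 1 ≤ (S.biUnion t).card := by
      refine le_trans ?_ (Finset.card_le_card (Finset.subset_biUnion_of_mem t hu))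
      have := Finset.pred_card_le_card_erase (s := Finset.Icc 1 Δ) (a := f u)
      simpa using this
    by_cases hS : S.card = Δ
    · have hdeg : G.degree v = Δ := by omega
      have hSu : S = Finset.univ := by
        apply Finset.eq_univ_of_card
        rw [Fintype.card_coe, SimpleGraph.card_neighborFinset_eq_degree, hS, hdeg]
      have hsub : Finset.Icc 1 Δ ⊆ S.biUnion t := by
        intro a ha
        obtain ⟨w, hw, hwa⟩ := hf a ha hdeg
        rw [Finset.mem_biUnion]
        refine ⟨⟨w, by simpa using hw⟩, by simp [hSu], ?_⟩
        exact Finset.mem_erase.2 ⟨fun h => hwa h.symm, ha⟩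
      have := Finset.card_le_card hsub
      simp at this
      omega
    · omega
  obtain ⟨g, hg, hgt⟩ := (Finset.all_card_le_biUnion_card_iff_exists_injective t).1 key
  refine ⟨fun u => if h : u ∈ G.neighborFinset v then g ⟨u, h⟩ else 0, ?_, ?_⟩
  · intro u hu
    have hu' : u ∈ G.neighborFinset v := by simpa using hu
    have := Finset.mem_erase.1 (hgt ⟨u, hu'⟩)
    simp only [hu', dif_pos]
    exact ⟨this.2, this.1⟩
  · intro u w hu hw h
    have hu' : u ∈ G.neighborFinset v := by simpa using hu
    have hw' : w ∈ G.neighborFinset v := by simpa using hw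
    simp only [hu', hw', dif_pos] at h
    have := hg h
    simpa using this

/-- `c` is a valid coloring of the darts whose source lies in `s`. -/
structure Valid {V : Type*} (G : SimpleGraph V) (Δ : ℕ) (c : V → V → ℕ) (s : Set V) : Prop where
  rng : ∀ v ∈ s, ∀ u, G.Adj v u → c v u ∈ Finset.Icc 1 Δ
  inj : ∀ v ∈ s, ∀ u w, G.Adj v u → G.Adj v w → c v u = c v w → u = w
  flip : ∀ v ∈ s, ∀ u ∈ s, G.Adj v u → c v u ≠ c u v

theorem Valid.mono {V : Type*} {G : SimpleGraph V} {Δ : ℕ} {c : V → V → ℕ} {s t : Set V}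
    (h : Valid G Δ c s) (hts : t ⊆ s) : Valid G Δ c t :=
  ⟨fun v hv => h.rng v (hts hv), fun v hv => h.inj v (hts hv),
    fun v hv u hu => h.flip v (hts hv) u (hts hu)⟩

theorem Valid.extend {V : Type*} [Fintype V] {G : SimpleGraph V} [DecidableRel G.Adj] {Δ : ℕ}
    {c : V → V → ℕ} {s : Set V} (h : Valid G Δ c s) (v : V) (hv : v ∉ s)
    (hd : G.degree v ≤ Δ)
    (hf : ∀ a ∈ Finset.Icc 1 Δ, G.degree v = Δ → ∃ u, G.Adj v u ∧ (u ∉ s ∨ c u v ≠ a)) :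
    ∃ c', Valid G Δ c' (insert v s) ∧ ∀ x, x ≠ v → c' x = c x := by
  classical
  obtain ⟨g, hg, hgi⟩ := hall_step G Δ v hd (fun u => if u ∈ s then c u v else 0) (by
    intro a ha hdeg
    obtain ⟨u, hu, h1⟩ := hf a ha hdeg
    refine ⟨u, hu, ?_⟩
    have : 1 ≤ a := (Finset.mem_Icc.1 ha).1
    by_cases hus : u ∈ s
    · simp only [hus, if_true]
      tauto
    · simp only [hus, if_false]
      omega)
  have hne : ∀ x ∈ s, x ≠ v := fun x hx hxv => hv (hxv ▸ hx)
  have hup : ∀ x, x ≠ v → Function.update c v g x = c x := fun x hx => by simp [hx]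
  refine ⟨Function.update c v g, ⟨?_, ?_, ?_⟩, hup⟩
  · rintro x (rfl | hx) u hu
    · simpa using (hg u hu).1
    · rw [hup x (hne x hx)]; exact h.rng x hx u hu
  · rintro x (rfl | hx) u w hu hw
    · simpa using hgi u w hu hw
    · rw [hup x (hne x hx)]; exact h.inj x hx u w hu hw
  · rintro x (rfl | hx) y (rfl | hy) hxy
    · exact absurd rfl hxy.ne
    · rw [hup y (hne y hy)]
      have := (hg y hxy).2
      simpa [hy] using this
    · rw [hup x (hne x hx)]
      have := (hg x hxy.symm).2
      simpa [hx] using this.symm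
    · rw [hup x (hne x hx), hup y (hne y hy)]
      exact h.flip x hx y hy hxy

/-- All vertices other than a given root can be colored. -/
theorem exists_valid_compl {V : Type*} [Fintype V] (G : SimpleGraph V) [DecidableRel G.Adj]
    (hconn : G.Connected) (Δ : ℕ) (hd : ∀ v, G.degree v ≤ Δ) (r : V) :
    ∃ c, Valid G Δ c {r}ᶜ := by
  classical
  have key : ∀ s : Finset V, r ∉ s → ∃ c, Valid G Δ c (s : Set V) := by
    intro s
    induction s using Finset.induction_on_min_value (fun x => G.dist x r) with
    | empty => intro _; exact ⟨fun _ _ => 0, by simp, by simp, by simp⟩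
    | insert a s has hmin ih =>
      intro hr
      have har : a ≠ r := fun h => hr (by simp [h])
      obtain ⟨c, hc⟩ := ih (fun h => hr (by simp [h]))
      obtain ⟨w, haw, hlt⟩ : ∃ w, G.Adj a w ∧ G.dist w r < G.dist a r := by
        obtain ⟨p, hp⟩ := hconn.exists_walk_length_eq_dist a r
        cases p with
        | nil => exact absurd rfl har
        | cons h q =>
          refine ⟨_, h, ?_⟩
          have := SimpleGraph.dist_le q
          simp at hp
          omega
      obtain ⟨c', hc', -⟩ := hc.extend a (by simpa using has) (hd a) (fun _ _ _ =>
        ⟨w, haw, Or.inl (fun hw => by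
          have := hmin w (by simpa using hw)
          omega)⟩)
      exact ⟨c', by simpa using hc'⟩
  obtain ⟨c, hc⟩ := key (Finset.univ.erase r) (by simp)
  exact ⟨c, hc.mono (by intro x; simp)⟩

/-- A stuck state at `w` with color `a`. -/
def Stuck {V : Type*} (G : SimpleGraph V) (Δ : ℕ) (c : V → V → ℕ) (w : V) (a : ℕ) : Prop :=
  Valid G Δ c {w}ᶜ ∧ a ∈ Finset.Icc 1 Δ ∧ ∀ u, G.Adj w u → c u w = a

theorem stuck_of_valid {V : Type*} [Fintype V] {G : SimpleGraph V} [DecidableRel G.Adj]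
    {Δ : ℕ} (hd : ∀ v, G.degree v ≤ Δ) (hno : ¬ ∃ c, Valid G Δ c Set.univ)
    {c : V → V → ℕ} {w : V} (h : Valid G Δ c {w}ᶜ) :
    G.degree w = Δ ∧ ∃ a, Stuck G Δ c w a := by
  by_contra hcon
  apply hno
  obtain ⟨c', hc', -⟩ := h.extend w (by simp) (hd w) (by
    intro a ha hdeg
    by_contra hall
    push Not at hall
    exact hcon ⟨hdeg, a, h, ha, fun u hu => (hall u hu).2⟩)
  exact ⟨c', hc'.mono (by intro x _; by_cases hx : x = w <;> simp [hx])⟩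

theorem Stuck.move {V : Type*} [Fintype V] {G : SimpleGraph V} [DecidableRel G.Adj]
    {Δ : ℕ} (hd : ∀ v, G.degree v ≤ Δ) (hno : ¬ ∃ c, Valid G Δ c Set.univ)
    {c : V → V → ℕ} {w w' : V} {a : ℕ} (h : Stuck G Δ c w a) (hadj : G.Adj w w') :
    ∃ c', Stuck G Δ c' w' a ∧ ∀ x, x ≠ w → c' x = c x := by
  classical
  obtain ⟨hv, ha, hall⟩ := h
  have hdeg := (stuck_of_valid hd hno hv).1
  obtain ⟨c', hc', hag⟩ := (hv.mono (t := {w, w'}ᶜ) (by intro x; simp; tauto)).extend w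
    (by simp) (hd w) (fun b _ _ => ⟨w', hadj, Or.inl (by simp)⟩)
  have hc2 : Valid G Δ c' {w'}ᶜ := hc'.mono (by
    intro x hx
    by_cases hxw : x = w
    · simp [hxw]
    · right
      simp at hx
      simp [hx, hxw])
  refine ⟨c', ?_, hag⟩
  obtain ⟨-, b, hb1, hb2, hb⟩ := stuck_of_valid hd hno hc2
  have hwmem : w ∈ ({w'}ᶜ : Set V) := by simpa using hadj.ne
  have himg : (G.neighborFinset w).image (c' w) = Finset.Icc 1 Δ := by
    apply Finset.eq_of_subset_of_card_le
    · intro x hx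
      obtain ⟨u, hu, rfl⟩ := Finset.mem_image.1 hx
      exact hc2.rng w hwmem u (by simpa using hu)
    · rw [Finset.card_image_of_injOn]
      · simp [hdeg]
      · intro u hu x hx hux
        exact hc2.inj w hwmem u x (by simpa using hu) (by simpa using hx) hux
  have : a ∈ (G.neighborFinset w).image (c' w) := himg ▸ ha
  obtain ⟨u, hu, hua⟩ := Finset.mem_image.1 this
  have hu : G.Adj w u := by simpa using hu
  have huw : u = w' := by
    by_contra hne
    apply hc2.flip w hwmem u (by simpa using hne) hu
    rw [hua, hag u hu.ne', hall u hu]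
  subst huw
  have : b = a := by rw [← hb w hu.symm, hua]
  subst this
  exact ⟨hc2, hb2, hb⟩

theorem exists_valid {V : Type*} [Fintype V] (G : SimpleGraph V) [DecidableRel G.Adj]
    (hconn : G.Connected) (Δ : ℕ) (hΔ : 3 ≤ Δ) (hd : ∀ v, G.degree v ≤ Δ) :
    ∃ c, Valid G Δ c Set.univ := by
  classical
  by_contra hno
  have hreg : ∀ v, G.degree v = Δ := fun v => by
    obtain ⟨c, hc⟩ := exists_valid_compl G hconn Δ hd v
    exact (stuck_of_valid hd hno hc).1
  have hnt : ¬ G.IsAcyclic := by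
    intro hac
    have hT : G.IsTree := ⟨hconn, hac⟩
    obtain ⟨v⟩ := hconn.nonempty
    have : Nontrivial V := by
      have : 0 < (G.neighborFinset v).card := by
        have := hreg v
        rw [SimpleGraph.card_neighborFinset_eq_degree]
        omega
      obtain ⟨u, hu⟩ := Finset.card_pos.1 this
      exact ⟨v, u, by simpa using (G.ne_of_adj (by simpa using hu))⟩
    obtain ⟨u, hu⟩ := hT.exists_vert_degree_one_of_nontrivial
    have := hreg u
    omega
  rw [SimpleGraph.isAcyclic_iff_forall_adj_isBridge] at hnt
  push Not at hnt
  obtain ⟨r, u₁, hadj, hnb⟩ := hnt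
  have hreach : (G.deleteEdges {s(r, u₁)}).Reachable u₁ r := by
    rw [SimpleGraph.isBridge_iff] at hnb
    exact (not_not.1 hnb).symm
  obtain ⟨c, hc⟩ := exists_valid_compl G hconn Δ hd r
  obtain ⟨-, a, hst⟩ := stuck_of_valid hd hno hc
  obtain ⟨c₁, hst₁, -⟩ := hst.move hd hno hadj
  have key : ∀ (w y : V) (p : (G.deleteEdges {s(r, u₁)}).Walk w y), y = r → w ≠ r →
      (∃ c, Stuck G Δ c w a ∧ c r u₁ = a) → False := by
    intro w y p
    induction p with
    | nil => intro h1 h2; exact absurd h1 h2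
    | @cons w w' y h q ih =>
      rintro rfl hw ⟨c, hs, hcr⟩
      rw [SimpleGraph.deleteEdges_adj] at h
      by_cases hw' : w' = y
      · subst hw'
        have h1 := hs.2.2 _ h.1
        have h2 := hs.1.inj w' (by simpa using hw.symm) w u₁ h.1.symm hadj (by rw [h1, hcr])
        apply h.2
        simp [h2, Sym2.eq_swap]
      · obtain ⟨c', hs', hag⟩ := hs.move hd hno h.1
        exact ih rfl hw' ⟨c', hs', by rw [hag y hw.symm, hcr]⟩
  obtain ⟨p⟩ := hreach
  exact key u₁ r p rfl hadj.ne' ⟨c₁, hst₁, hst₁.2.2 r hadj.symm⟩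

/-- Normal form for points of the 3-subdivision. -/
def nfPre {V : Type*} (G : SimpleGraph V) (p : SubdivPre G 3) : V × Option V :=
  if p.1.2.2 = 0 then (p.1.1, none)
  else if p.1.2.2 = 1 then (p.1.1, some p.1.2.1)
  else if p.1.2.2 = 2 then (p.1.2.1, some p.1.1)
  else (p.1.2.1, none)

def nf {V : Type*} (G : SimpleGraph V) : SubdivVert G 3 → V × Option V :=
  Quot.lift (nfPre G) (by
    rintro _ _ (⟨u, v, i, h, hi⟩ | ⟨u, v, h⟩)
    · interval_cases i <;> simp [nfPre]
    · simp [nfPre])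

theorem nf_branch {V : Type*} (G : SimpleGraph V) (u : V) : nf G (branchVertex G 3 u) = (u, none) :=
  rfl

theorem nf_one {V : Type*} (G : SimpleGraph V) {u v : V} (h : G.Adj u v) (h1 : 1 ≤ 3) :
    nf G (mkVert G 3 h 1 h1) = (u, some v) := rfl

theorem mk_zero {V : Type*} (G : SimpleGraph V) {u v : V} (h : G.Adj u v) (h1 : 0 ≤ 3) :
    mkVert G 3 h 0 h1 = branchVertex G 3 u := Quot.sound (.collapse u v h)

theorem mk_two {V : Type*} (G : SimpleGraph V) {u v : V} (h : G.Adj u v) (h1 : 2 ≤ 3) :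
    mkVert G 3 h 2 h1 = mkVert G 3 h.symm 1 (by norm_num) := Quot.sound (.flip u v 2 h h1)

theorem mk_three {V : Type*} (G : SimpleGraph V) {u v : V} (h : G.Adj u v) (h1 : 3 ≤ 3) :
    mkVert G 3 h 3 h1 = branchVertex G 3 v :=
  (Quot.sound (.flip u v 3 h h1)).trans (mk_zero G h.symm (by norm_num))

theorem vert_cases {V : Type*} (G : SimpleGraph V) (x : SubdivVert G 3) :
    (∃ u, x = branchVertex G 3 u) ∨
      ∃ (u v : V) (h : G.Adj u v), x = mkVert G 3 h 1 (by norm_num) := by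
  induction x using Quot.ind with
  | mk p =>
    obtain ⟨⟨u, v, i⟩, (⟨h1, h2⟩ | ⟨h1, h2⟩)⟩ := p
    · dsimp at h1 h2
      subst h1 h2
      exact Or.inl ⟨u, rfl⟩
    · dsimp at h1 h2
      change (∃ w, mkVert G 3 h1 i h2 = _) ∨ ∃ (u' v' : V) (h : G.Adj u' v'), mkVert G 3 h1 i h2 = _
      interval_cases i
      · exact Or.inl ⟨u, mk_zero G h1 _⟩
      · exact Or.inr ⟨u, v, h1, rfl⟩
      · exact Or.inr ⟨v, u, h1.symm, mk_two G h1 _⟩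
      · exact Or.inl ⟨v, mk_three G h1 _⟩

theorem nf_injective {V : Type*} (G : SimpleGraph V) : Function.Injective (nf G) := by
  intro x y hxy
  rcases vert_cases G x with ⟨u, rfl⟩ | ⟨u, v, h, rfl⟩ <;>
  rcases vert_cases G y with ⟨u', rfl⟩ | ⟨u', v', h', rfl⟩ <;>
  simp only [nf_branch, nf_one, Prod.mk.injEq, Option.some.injEq, reduceCtorEq, and_false,
    and_true] at hxy
  · rw [hxy]
  · obtain ⟨rfl, rfl⟩ := hxy
    rfl

theorem adj_cases {V : Type*} (G : SimpleGraph V) {x y : SubdivVert G 3}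
    (h : (subdivision G 3).Adj x y) : ∃ u v, G.Adj u v ∧
      ((nf G x = (u, none) ∧ nf G y = (u, some v)) ∨ (nf G x = (u, some v) ∧ nf G y = (u, none)) ∨
        (nf G x = (u, some v) ∧ nf G y = (v, some u))) := by
  rw [subdivision, SimpleGraph.fromRel_adj] at h
  obtain ⟨-, ⟨u, v, h, i, hi, rfl, rfl⟩ | ⟨u, v, h, i, hi, rfl, rfl⟩⟩ := h
  · interval_cases i
    · exact ⟨u, v, h, Or.inl ⟨rfl, rfl⟩⟩
    · exact ⟨u, v, h, Or.inr (Or.inr ⟨rfl, rfl⟩)⟩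
    · exact ⟨v, u, h.symm, Or.inr (Or.inl ⟨rfl, rfl⟩)⟩
  · interval_cases i
    · exact ⟨u, v, h, Or.inr (Or.inl ⟨rfl, rfl⟩)⟩
    · exact ⟨v, u, h.symm, Or.inr (Or.inr ⟨rfl, rfl⟩)⟩
    · exact ⟨v, u, h.symm, Or.inl ⟨rfl, rfl⟩⟩

/-- The color of a point in normal form. -/
def col {V : Type*} (c : V → V → ℕ) : V × Option V → ℕ
  | (_, none) => 0
  | (u, some v) => c u v

theorem col_ne_of_walk {V : Type*} {G : SimpleGraph V} {Δ : ℕ} {c : V → V → ℕ}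
    (hc : Valid G Δ c Set.univ) {x y : SubdivVert G 3} (hxy : x ≠ y)
    (w : (subdivision G 3).Walk x y) (hw : w.length ≤ 2) :
    col c (nf G x) ≠ col c (nf G y) := by
  have hpos : ∀ u v, G.Adj u v → c u v ≠ 0 := fun u v h => by
    have := Finset.mem_Icc.1 (hc.rng u trivial v h)
    omega
  have hflip : ∀ u v, G.Adj u v → c u v ≠ c v u := fun u v h => hc.flip u trivial v trivial h
  have hinj := fun u => hc.inj u trivial
  have hne : nf G x ≠ nf G y := fun h => hxy (nf_injective G h)
  match w, hw with
  | .nil, _ => exact absurd rfl hxy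
  | .cons h .nil, _ =>
    obtain ⟨u, v, huv, ⟨h1, h2⟩ | ⟨h1, h2⟩ | ⟨h1, h2⟩⟩ := adj_cases G h <;> rw [h1, h2] <;>
      simp only [col]
    · exact (hpos u v huv).symm
    · exact hpos u v huv
    · exact hflip u v huv
  | .cons h (.cons h' .nil), _ =>
    obtain ⟨u, v, huv, ⟨h1, h2⟩ | ⟨h1, h2⟩ | ⟨h1, h2⟩⟩ := adj_cases G h <;>
    obtain ⟨u', v', huv', ⟨h3, h4⟩ | ⟨h3, h4⟩ | ⟨h3, h4⟩⟩ := adj_cases G h' <;>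
    rw [h2] at h3 <;>
    simp only [Prod.mk.injEq, Option.some.injEq, reduceCtorEq, and_false, and_true] at h3 <;>
    rw [h1, h4] at hne ⊢ <;>
    have hs := huv.symm <;>
    have hs' := huv'.symm <;>
    simp only [col] <;> grind
  | .cons _ (.cons _ (.cons _ _)), hw => simp at hw

end G23

theorem exists_coloring_G23_zero_iff_branch {V : Type*} [Fintype V] (G : SimpleGraph V)
    [DecidableRel G.Adj] (hconn : G.Connected) (hΔ : 3 ≤ G.maxDegree) :
    ∃ h : SubdivVert G 3 → ℕ,
      (∀ x y, (fracPower G 2 3).Adj x y → h x ≠ h y) ∧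
      (∀ x, h x ≤ G.maxDegree) ∧
      (∀ x, h x = 0 ↔ ∃ u, x = branchVertex G 3 u) := by
  obtain ⟨c, hc⟩ := G23.exists_valid G hconn G.maxDegree hΔ (fun v => G.degree_le_maxDegree v)
  refine ⟨fun x => G23.col c (G23.nf G x), ?_, ?_, ?_⟩
  · intro x y hxy
    rw [fracPower, powerGraph, SimpleGraph.fromRel_adj] at hxy
    obtain ⟨hne, ⟨w, hw⟩ | ⟨w, hw⟩⟩ := hxy
    · exact G23.col_ne_of_walk hc hne w hw
    · exact (G23.col_ne_of_walk hc hne.symm w hw).symm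
  · intro x
    rcases G23.vert_cases G x with ⟨u, rfl⟩ | ⟨u, v, h, rfl⟩
    · exact Nat.zero_le _
    · exact (Finset.mem_Icc.1 (hc.rng u trivial v h)).2
  · intro x
    constructor
    · intro hx
      rcases G23.vert_cases G x with hu | ⟨u, v, h, rfl⟩
      · exact hu
      · have := (Finset.mem_Icc.1 (hc.rng u trivial v h)).1
        have hx : c u v = 0 := hx
        omega
    · rintro ⟨u, rfl⟩
      rfl
end

section
/- If G is a finite simple graph with maximum degree Δ ≥ 3, then there exists a proper edge coloring h : E(G^{1/2}) → {1, …, Δ} of the 2-subdivision of G with Δ colors (a half-edge coloring of G). -/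
open SimpleGraph

/-- The half-edge `e_{uv}`: the edge of the `2`-subdivision `G^{1/2}` joining the branch
vertex `u` to the subdivision vertex of the edge `uv`. -/
def halfEdge {V : Type*} (G : SimpleGraph V) {u v : V} (h : G.Adj u v) :
    Sym2 (SubdivVert G 2) :=
  s(branchVertex G 2 u, mkVert G 2 h 1 (by omega))

/-- `h` is a proper edge coloring of `H`: distinct edges sharing a vertex get
different colors. -/
def IsProperEdgeColoring {W : Type*} (H : SimpleGraph W) (h : Sym2 W → ℕ) : Prop :=
  ∀ e₁ ∈ H.edgeSet, ∀ e₂ ∈ H.edgeSet, e₁ ≠ e₂ → (∃ x, x ∈ e₁ ∧ x ∈ e₂) → h e₁ ≠ h e₂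

/-- Two fixed-point-free involutions admit a common alternating 2-coloring. -/
lemma exists_alt_of_involutions {X : Type*} (s t : Equiv.Perm X)
    (hs : ∀ x, s (s x) = x) (ht : ∀ x, t (t x) = x)
    (hs' : ∀ x, s x ≠ x) (ht' : ∀ x, t x ≠ x) :
    ∃ f : X → Bool, ∀ x, f (s x) ≠ f x ∧ f (t x) ≠ f x := by
  classical
  have hss : s * s = 1 := by ext x; simp [hs]
  have htt : t * t = 1 := by ext x; simp [ht]
  have hsi : s⁻¹ = s := inv_eq_of_mul_eq_one_left hss
  have hti : t⁻¹ = t := inv_eq_of_mul_eq_one_left htt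
  have hconj : ∀ k : ℤ, s * (s * t) ^ k * s = (s * t) ^ (-k) := by
    intro k
    have h1 : s * (s * t) ^ k * s⁻¹ = (s * (s * t) * s⁻¹) ^ k := (conj_zpow ..).symm
    rw [hsi] at h1
    have h2 : s * (s * t) * s = (s * t)⁻¹ := by
      rw [mul_inv_rev, hsi, hti, ← mul_assoc, hss, one_mul]
    rw [h1, h2, inv_zpow, zpow_neg]
  have key : ∀ (k : ℤ) x, ((s * t) ^ k) x ≠ s x := by
    intro k x h
    rcases Int.even_or_odd' k with ⟨m, rfl | rfl⟩
    · apply hs' (((s * t) ^ m) x)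
      have h2 : s * (s * t) ^ m = (s * t) ^ (-m) * s := by
        rw [← hconj, mul_assoc, mul_assoc, hss, mul_one]
      have : (s * (s * t) ^ m) x = ((s * t) ^ m) x := by
        rw [h2, Equiv.Perm.mul_apply, ← h, ← Equiv.Perm.mul_apply, ← zpow_add]
        congr 2; ring
      exact this
    · apply ht' (((s * t) ^ m) x)
      have h2 : t * (s * t) ^ m = (s * t) ^ (-m - 1) * s := by
        have h3 : s * (s * t) ^ (m + 1) = (s * t) ^ (-(m + 1)) * s := by
          rw [← hconj, mul_assoc, mul_assoc, hss, mul_one]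
        rw [show (-m - 1 : ℤ) = -(m + 1) by ring, ← h3, add_comm, zpow_add, zpow_one,
          ← mul_assoc, ← mul_assoc, hss, one_mul]
      have : (t * (s * t) ^ m) x = ((s * t) ^ m) x := by
        rw [h2, Equiv.Perm.mul_apply, ← h, ← Equiv.Perm.mul_apply, ← zpow_add]
        congr 2; ring
      exact this
  let st : Setoid X := Equiv.Perm.SameCycle.setoid (s * t)
  let Q := Quotient st
  have hmk : ∀ x y, (Quotient.mk st x = Quotient.mk st y) ↔ (s * t).SameCycle x y :=
    fun x y => Quotient.eq
  have hS : ∀ x y, (s * t).SameCycle x y → (s * t).SameCycle (s x) (s y) := by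
    rintro x y ⟨k, rfl⟩
    refine ⟨-k, ?_⟩
    rw [← hconj]; simp [hs]
  let q : X → Q := Quotient.mk st
  let sq : Q → Q := Quotient.map s hS
  have hq : ∀ x, q (s x) = sq (q x) := fun x => rfl
  have hsq : ∀ z, sq (sq z) = z := by
    rintro ⟨x⟩
    change q (s (s x)) = q x
    rw [hs]
  have hne : ∀ z, sq z ≠ z := by
    rintro ⟨x⟩ h
    have h' : q (s x) = q x := h
    obtain ⟨k, hk⟩ := ((hmk _ _).1 h').symm
    exact key k x hk
  have htq : ∀ x, q (t x) = sq (q x) := by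
    intro x
    have : q (s (t x)) = q x := by
      refine (hmk _ _).2 ⟨-1, ?_⟩
      simp [hsi, hti, hs, ht]
    rw [← this, hq, hsq]
  let r : Q → Q → Prop := WellOrderingRel
  have hr : ∀ z, decide (r (sq z) (sq (sq z))) ≠ decide (r z (sq z)) := by
    intro z
    rw [hsq]
    rcases trichotomous_of r z (sq z) with h | h | h
    · have := asymm_of r h
      simp [h, this]
    · exact absurd h.symm (hne z)
    · have := asymm_of r h
      simp [h, this]
  refine ⟨fun x => decide (r (q x) (sq (q x))), fun x => ⟨?_, ?_⟩⟩
  · simp only [hq]; exact hr _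
  · simp only [htq]; exact hr _

/-- Fibers of size at most two give a fixed-point-free involution of the double. -/
lemma exists_invol {D A : Type*} (a : D → A)
    (ha : ∀ x y z, a x = a y → a x = a z → x = y ∨ x = z ∨ y = z) :
    ∃ s : Equiv.Perm (D × Bool), (∀ x, s (s x) = x) ∧ (∀ x, s x ≠ x) ∧
      ∀ x y b, x ≠ y → a x = a y → s (x, b) = (y, b) := by
  classical
  let f : D × Bool → D × Bool := fun p =>
    if h : ∃ y, p.1 ≠ y ∧ a p.1 = a y then (h.choose, p.2) else (p.1, !p.2)
  have h1 : ∀ x y b, x ≠ y → a x = a y → f (x, b) = (y, b) := by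
    intro x y b hxy hab
    have h : ∃ y, (x, b).1 ≠ y ∧ a (x, b).1 = a y := ⟨y, hxy, hab⟩
    simp only [f, dif_pos h]
    have := h.choose_spec
    rcases ha x y h.choose hab this.2 with h' | h' | h'
    · exact absurd h' hxy
    · exact absurd h' this.1
    · rw [← h']
  have h2 : ∀ x b, (¬ ∃ y, x ≠ y ∧ a x = a y) → f (x, b) = (x, !b) := by
    intro x b h
    simp only [f]
    rw [dif_neg h]
  have hinv : ∀ p, f (f p) = p := by
    rintro ⟨x, b⟩
    by_cases h : ∃ y, x ≠ y ∧ a x = a y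
    · obtain ⟨y, hy, hy'⟩ := h
      rw [h1 x y b hy hy', h1 y x b hy.symm hy'.symm]
    · rw [h2 x b h, h2 x _ h, Bool.not_not]
  have hne : ∀ p, f p ≠ p := by
    rintro ⟨x, b⟩
    by_cases h : ∃ y, x ≠ y ∧ a x = a y
    · obtain ⟨y, hy, hy'⟩ := h
      rw [h1 x y b hy hy']
      intro h; exact hy (congrArg Prod.fst h).symm
    · rw [h2 x b h]
      simp
  exact ⟨⟨f, f, hinv, hinv⟩, hinv, hne, h1⟩

lemma two_coloring {D A B : Type*} (a : D → A) (b : D → B)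
    (ha : ∀ x y z, a x = a y → a x = a z → x = y ∨ x = z ∨ y = z)
    (hb : ∀ x y z, b x = b y → b x = b z → x = y ∨ x = z ∨ y = z) :
    ∃ f : D → Bool, ∀ x y, x ≠ y → (a x = a y ∨ b x = b y) → f x ≠ f y := by
  obtain ⟨s, hs, hs', hs''⟩ := exists_invol a ha
  obtain ⟨t, ht, ht', ht''⟩ := exists_invol b hb
  obtain ⟨f, hf⟩ := exists_alt_of_involutions s t hs ht hs' ht'
  refine ⟨fun x => f (x, true), ?_⟩
  rintro x y hxy (h | h)
  · have := (hf (x, true)).1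
    rw [hs'' x y true hxy h] at this
    exact this.symm
  · have := (hf (x, true)).2
    rw [ht'' x y true hxy h] at this
    exact this.symm

lemma fiber_two {D A : Type*} [DecidableEq A] (T : Finset D) (a : D → A)
    (ha : ∀ v, (T.filter (fun d => a d = v)).card ≤ 2) :
    ∀ x y z : T, a x = a y → a x = a z → x = y ∨ x = z ∨ y = z := by
  classical
  intro x y z hxy hxz
  by_contra! h
  have : 2 < (T.filter (fun d => a d = a x)).card := by
    rw [Finset.two_lt_card]
    refine ⟨x, by simp, y, by simp [hxy], z, by simp [hxz], ?_, ?_, ?_⟩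
    · exact fun e => h.1 (Subtype.ext e)
    · exact fun e => h.2.1 (Subtype.ext e)
    · exact fun e => h.2.2 (Subtype.ext e)
  exact absurd (ha (a x)) (by omega)

lemma bip_coloring {D A B : Type*} [DecidableEq D] [DecidableEq A] [DecidableEq B] [Fintype A]
    (a : D → A) (b : D → B) (k : ℕ) (hk : 2 ≤ k) : ∀ T : Finset D,
    (∀ v, (T.filter (fun d => a d = v)).card ≤ k) →
    (∀ v, (T.filter (fun d => b d = v)).card ≤ 2) →
    ∃ c : D → ℕ, (∀ d ∈ T, c d < k) ∧
      ∀ d ∈ T, ∀ e ∈ T, d ≠ e → (a d = a e ∨ b d = b e) → c d ≠ c e := by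
  induction k, hk using Nat.le_induction with
  | base =>
    intro T ha hb
    obtain ⟨f, hf⟩ := two_coloring (fun d : T => a d) (fun d : T => b d)
      (fiber_two T a ha) (fiber_two T b hb)
    refine ⟨fun d => if h : d ∈ T then (f ⟨d, h⟩).toNat else 0, ?_, ?_⟩
    · intro d hd
      simp only [dif_pos hd]
      exact Bool.toNat_lt _
    · intro d hd e he hde hor
      simp only [dif_pos hd, dif_pos he]
      have := hf ⟨d, hd⟩ ⟨e, he⟩ (fun h => hde (congrArg Subtype.val h)) hor
      intro h
      revert h this
      cases f ⟨d, hd⟩ <;> cases f ⟨e, he⟩ <;> simp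
  | succ k hk ih =>
    intro T ha hb
    let S := {v : A // (T.filter (fun d => a d = v)).card = k + 1}
    let F : S → Finset D := fun v => T.filter (fun d => a d = v.1)
    have hall : ∃ g : S → B, Function.Injective g ∧ ∀ v, g v ∈ (F v).image b := by
      rw [← Finset.all_card_le_biUnion_card_iff_exists_injective]
      intro s
      have h1 : (s.biUnion F).card = s.card * (k + 1) := by
        rw [Finset.card_biUnion]
        · rw [Finset.sum_const_nat (m := k + 1) (fun x _ => x.2)]
        · intro x _ y _ hxy
          change Disjoint (F x) (F y)
          rw [Finset.disjoint_left]
          intro d hd hd'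
          simp only [F, Finset.mem_filter] at hd hd'
          exact hxy (Subtype.ext (hd.2.symm.trans hd'.2))
      have h2 : (s.biUnion F).card ≤ 2 * (s.biUnion (fun v => (F v).image b)).card := by
        apply Finset.card_le_mul_card_image_of_maps_to (f := b)
        · intro d hd
          simp only [Finset.mem_biUnion, Finset.mem_image] at hd ⊢
          obtain ⟨v, hv, hd⟩ := hd
          exact ⟨v, hv, d, hd, rfl⟩
        · intro w _
          refine le_trans (Finset.card_le_card ?_) (hb w)
          apply Finset.filter_subset_filter
          intro d hd
          simp only [Finset.mem_biUnion] at hd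
          obtain ⟨v, hv, hd⟩ := hd
          exact (Finset.mem_filter.1 hd).1
      nlinarith
    obtain ⟨g, hg, hgm⟩ := hall
    have : ∀ v, ∃ d, d ∈ T ∧ a d = v.1 ∧ b d = g v := by
      intro v
      obtain ⟨d, hd, hd'⟩ := Finset.mem_image.1 (hgm v)
      exact ⟨d, (Finset.mem_filter.1 hd).1, (Finset.mem_filter.1 hd).2, hd'⟩
    choose m hmT hma hmb using this
    let M : Finset D := Finset.univ.image m
    have hM : ∀ d ∈ M, ∀ e ∈ M, d ≠ e → ¬ (a d = a e ∨ b d = b e) := by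
      intro d hd e he hde
      obtain ⟨v, -, rfl⟩ := Finset.mem_image.1 hd
      obtain ⟨w, -, rfl⟩ := Finset.mem_image.1 he
      rintro (h | h)
      · rw [hma, hma] at h
        exact hde (congrArg m (Subtype.ext h))
      · rw [hmb, hmb] at h
        exact hde (congrArg m (hg h))
    obtain ⟨c, hc1, hc2⟩ := ih (T \ M) (by
        intro v
        by_cases hv : (T.filter (fun d => a d = v)).card = k + 1
        · have : (T \ M).filter (fun d => a d = v) ⊂ T.filter (fun d => a d = v) := by
            rw [Finset.ssubset_iff_of_subset
              (Finset.filter_subset_filter _ Finset.sdiff_subset)]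
            refine ⟨m ⟨v, hv⟩, ?_, ?_⟩
            · simp [hmT, hma]
            · simp [M]
          have := Finset.card_lt_card this
          omega
        · have h1 := Finset.card_le_card (Finset.filter_subset_filter (fun d => a d = v)
            (Finset.sdiff_subset : T \ M ⊆ T))
          have := ha v
          omega)
      (fun v => le_trans (Finset.card_le_card (Finset.filter_subset_filter _
            Finset.sdiff_subset)) (hb v))
    refine ⟨fun d => if d ∈ M then k else c d, ?_, ?_⟩
    · intro d hd
      by_cases hdM : d ∈ M
      · simp [hdM]
      · simp only [hdM, if_false]
        have := hc1 d (by simp [hd, hdM])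
        omega
    · intro d hd e he hde hor
      by_cases hdM : d ∈ M <;> by_cases heM : e ∈ M <;> simp only [hdM, heM, if_true, if_false]
      · exact absurd hor (hM d hdM e heM hde)
      · have := hc1 e (by simp [he, heM])
        omega
      · have := hc1 d (by simp [hd, hdM])
        omega
      · exact hc2 d (by simp [hd, hdM]) e (by simp [he, heM]) hde hor

/-- Invariant distinguishing the vertices of the 2-subdivision. -/
def subdivInv {V : Type*} (G : SimpleGraph V) : SubdivVert G 2 → V ⊕ Sym2 V :=
  Quot.lift (fun p => if p.1.2.2 = 0 then Sum.inl p.1.1 else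
    if p.1.2.2 = 1 then Sum.inr s(p.1.1, p.1.2.1) else Sum.inl p.1.2.1) (by
      rintro _ _ (⟨u, v, i, h, hi⟩ | ⟨u, v, h⟩)
      · interval_cases i <;> simp [Sym2.eq_swap]
      · simp)

lemma edge_is_halfEdge {V : Type*} (G : SimpleGraph V) (e : Sym2 (SubdivVert G 2))
    (he : e ∈ (subdivision G 2).edgeSet) : ∃ d : G.Dart, halfEdge G d.adj = e := by
  have main : ∀ x y, (∃ (u v : V) (h : G.Adj u v) (i : ℕ) (hi : i < 2),
    x = mkVert G 2 h i (le_of_lt hi) ∧ y = mkVert G 2 h (i + 1) hi) →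
      ∃ d : G.Dart, halfEdge G d.adj = s(x, y) := by
    rintro x y ⟨u, v, h, i, hi, rfl, rfl⟩
    have hc : ∀ {u v : V} (h : G.Adj u v), mkVert G 2 h 0 (by omega) = branchVertex G 2 u :=
      fun h => Quot.sound (SubdivRel.collapse _ _ h)
    have hf1 : mkVert G 2 h 1 (by omega) = mkVert G 2 h.symm 1 (by omega) :=
      Quot.sound (SubdivRel.flip u v 1 h (by omega))
    have hf2 : mkVert G 2 h 2 (by omega) = mkVert G 2 h.symm 0 (by omega) :=
      Quot.sound (SubdivRel.flip u v 2 h (by omega))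
    interval_cases i
    · exact ⟨⟨(u, v), h⟩, by simp only [halfEdge, hc]⟩
    · refine ⟨⟨(v, u), h.symm⟩, ?_⟩
      simp only [halfEdge]
      rw [hf1, hf2, hc, Sym2.eq_swap]
  induction e using Sym2.ind with
  | _ x y =>
    rw [SimpleGraph.mem_edgeSet, subdivision, SimpleGraph.fromRel_adj] at he
    rcases he.2 with h | h
    · exact main _ _ h
    · rw [Sym2.eq_swap]; exact main _ _ h

lemma halfEdge_share {V : Type*} (G : SimpleGraph V) (d e : G.Dart) (x : SubdivVert G 2)
    (hd : x ∈ halfEdge G d.adj) (he : x ∈ halfEdge G e.adj) :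
    d.fst = e.fst ∨ d.edge = e.edge := by
  have h1 : ∀ d : G.Dart, x ∈ halfEdge G d.adj →
      subdivInv G x = Sum.inl d.fst ∨ subdivInv G x = Sum.inr d.edge := by
    intro d hd
    rcases Sym2.mem_iff.1 hd with rfl | rfl
    · left; rfl
    · right; rfl
  rcases h1 d hd with h | h <;> rcases h1 e he with h' | h' <;> rw [h] at h' <;> simp_all

theorem exists_halfEdge_coloring {V : Type*} [Fintype V] (G : SimpleGraph V)
    [DecidableRel G.Adj] (hΔ : 3 ≤ G.maxDegree) :
    ∃ h : Sym2 (SubdivVert G 2) → ℕ,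
      (∀ e ∈ (subdivision G 2).edgeSet, h e ∈ Finset.Icc 1 G.maxDegree) ∧
      IsProperEdgeColoring (subdivision G 2) h := by
  classical
  obtain ⟨c, hc1, hc2⟩ := bip_coloring (fun d : G.Dart => d.fst) (fun d : G.Dart => d.edge)
    G.maxDegree (by omega) Finset.univ
    (fun v => by
      have := G.dart_fst_fiber_card_eq_degree v
      have h2 := G.degree_le_maxDegree v
      convert this.le.trans h2)
    (fun w => by
      by_cases hw : w ∈ G.edgeSet
      · exact (G.dart_edge_fiber_card w hw).le
      · rw [Finset.filter_false_of_mem]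
        · simp
        · rintro d - rfl
          exact hw d.edge_mem)
  have hE := edge_is_halfEdge G
  refine ⟨fun e => if h : e ∈ (subdivision G 2).edgeSet then c (hE e h).choose + 1 else 0, ?_, ?_⟩
  · intro e he
    simp only [dif_pos he]
    have := hc1 (hE e he).choose (Finset.mem_univ _)
    rw [Finset.mem_Icc]
    omega
  · rintro e he e' he' hne ⟨x, hx, hx'⟩
    simp only [dif_pos he, dif_pos he']
    have h1 := (hE e he).choose_spec
    have h2 := (hE e' he').choose_spec
    have := hc2 (hE e he).choose (Finset.mem_univ _) (hE e' he').choose (Finset.mem_univ _)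
      (fun h => hne (by rw [← h1, ← h2, h]))
      (halfEdge_share G _ _ x (by rw [h1]; exact hx) (by rw [h2]; exact hx'))
    omega
end

section
/- Every finite cubic (3-regular) simple graph G admits a good half-edge coloring: a proper edge coloring h : E(G^{1/2}) → {1, 2, 3} such that no cycle of G is bad, i.e., for every cycle C of G, the set of colors h assigns to the half-edges of the edges of C is not contained in a two-element subset of {1, 2, 3}. -/
open SimpleGraph

namespace GoodHalfEdge

/-- Fixed-point-free case: the union of two perfect matchings is bipartite. -/
lemma two_matchings_fpf {X : Type*} (α β : X → X) (hα : Function.Involutive α)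
    (hβ : Function.Involutive β) (fα : ∀ h, α h ≠ h) (fβ : ∀ h, β h ≠ h) :
    ∃ x : X → Bool, ∀ h, x (α h) ≠ x h ∧ x (β h) ≠ x h := by
  classical
  let A : Equiv.Perm X := hα.toPerm
  let B : Equiv.Perm X := hβ.toPerm
  have hA : A * A = 1 := by ext h; exact hα h
  have hB : B * B = 1 := by ext h; exact hβ h
  have hAi : A⁻¹ = A := inv_eq_of_mul_eq_one_left hA
  have hBi : B⁻¹ = B := inv_eq_of_mul_eq_one_left hB
  have hconj : A * (A * B) * A⁻¹ = (A * B)⁻¹ := by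
    rw [mul_inv_rev, hAi, hBi, ← mul_assoc, hA, one_mul]
  have hcz : ∀ k : ℤ, A * (A * B) ^ k = (A * B) ^ (-k) * A := by
    intro k
    have h1 : A * (A * B) ^ k * A⁻¹ = (A * B) ^ (-k) := by
      rw [← conj_zpow, hconj, inv_zpow, zpow_neg]
    rw [← h1, inv_mul_cancel_right]
  have hczx : ∀ (k : ℤ) (h : X), A (((A * B) ^ k) h) = ((A * B) ^ (-k)) (A h) := by
    intro k h
    exact congrArg (fun g : Equiv.Perm X => g h) (hcz k)
  let S := Equiv.Perm.SameCycle.setoid (A * B)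
  let Q := Quotient S
  have claim : ∀ h, ¬ (A * B).SameCycle h (A h) := by
    rintro h ⟨k, hk⟩
    rcases Int.even_or_odd' k with ⟨j, rfl | rfl⟩
    · apply fα (((A * B) ^ j) h)
      change A _ = _
      rw [hczx, ← hk, ← Equiv.Perm.mul_apply, ← zpow_add]
      congr 2; ring
    · apply fβ (((A * B) ^ j) h)
      change B _ = _
      apply A.injective
      rw [hczx, ← hk]
      have : A (B (((A * B) ^ j) h)) = ((A * B) ^ (1 + j)) h := by
        rw [zpow_add, zpow_one]; rfl
      rw [this, ← Equiv.Perm.mul_apply, ← zpow_add]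
      congr 2; ring
  have hAmap : ∀ a b, (A * B).SameCycle a b → (A * B).SameCycle (A a) (A b) := by
    rintro a b ⟨k, rfl⟩
    exact ⟨-k, (hczx k a).symm⟩
  let Abar : Q → Q := Quotient.map A hAmap
  have hne : ∀ q, Abar q ≠ q := by
    intro q
    induction q using Quotient.inductionOn with
    | h a =>
      intro he
      exact claim a (Quotient.exact he).symm
  have hinv : ∀ q, Abar (Abar q) = q := by
    intro q
    induction q using Quotient.inductionOn with
    | h a => exact congrArg (Quotient.mk S) (hα a)
  let _ : LinearOrder Q := WellOrderingRel.isWellOrder.linearOrder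
  let y : Q → Bool := fun q => decide (q < Abar q)
  have hy : ∀ q, y (Abar q) ≠ y q := by
    intro q
    simp only [y, hinv, ne_eq, decide_eq_decide]
    rcases lt_or_gt_of_ne (hne q) with h | h
    · intro hh; exact lt_asymm h (hh.1 h)
    · intro hh; exact lt_asymm h (hh.2 h)
  refine ⟨fun h => y (Quotient.mk S h), fun h => ⟨hy (Quotient.mk S h), ?_⟩⟩
  have : (Quotient.mk S (β h)) = Abar (Quotient.mk S h) := by
    apply Quotient.sound
    refine ⟨1, ?_⟩
    change A (B (β h)) = A h
    congr 1
    exact hβ h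
  simp only [this]
  exact hy _

/-- The union of two (partial) matchings is bipartite. -/
lemma two_matchings {X : Type*} (α β : X → X) (hα : Function.Involutive α)
    (hβ : Function.Involutive β) :
    ∃ x : X → Bool, ∀ h, (α h ≠ h → x (α h) ≠ x h) ∧ (β h ≠ h → x (β h) ≠ x h) := by
  classical
  let lift : (X → X) → (X × Bool → X × Bool) :=
    fun g p => if g p.1 = p.1 then (p.1, !p.2) else (g p.1, p.2)
  have hl : ∀ g : X → X, Function.Involutive g → Function.Involutive (lift g) := by
    rintro g hg ⟨a, b⟩
    by_cases h : g a = a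
    · simp [lift, h]
    · have h' : ¬ a = g a := fun e => h e.symm
      simp [lift, h, h', hg a]
  have hf : ∀ g : X → X, ∀ p, lift g p ≠ p := by
    rintro g ⟨a, b⟩
    by_cases h : g a = a
    · simp [lift, h]
    · simp [lift, h]
  obtain ⟨x, hx⟩ := two_matchings_fpf (lift α) (lift β) (hl α hα) (hl β hβ) (hf α) (hf β)
  refine ⟨fun a => x (a, false), fun h => ⟨fun e => ?_, fun e => ?_⟩⟩
  · have := (hx (h, false)).1
    simpa [lift, e] using this
  · have := (hx (h, false)).2
    simpa [lift, e] using this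

/-- An involution swapping, in every cycle of `f`, some point with its image. -/
lemma exists_gamma {V : Type*} [Finite V] (f : V → V) :
    ∃ γ : V → V, Function.Involutive γ ∧
      ∀ W : Set V, W.Nonempty → (∀ u ∈ W, f u ∈ W) → ∃ a ∈ W, γ a = f a := by
  classical
  let S : V → Set V := fun u => {w | ∃ n, f^[n] u = w}
  have hself : ∀ u, u ∈ S u := fun u => ⟨0, rfl⟩
  have hsub : ∀ u w, w ∈ S u → S w ⊆ S u := by
    rintro u w ⟨n, rfl⟩ z ⟨m, rfl⟩
    exact ⟨m + n, Function.iterate_add_apply f m n u⟩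
  have hfS : ∀ u, f u ∈ S u := fun u => ⟨1, rfl⟩
  -- recurrent points
  let R : V → Prop := fun u => ∀ w ∈ S u, u ∈ S w
  have hR : ∀ u w, R u → w ∈ S u → S w = S u ∧ R w := by
    intro u w hu hw
    have e : S w = S u := (hsub u w hw).antisymm (hsub w u (hu w hw))
    refine ⟨e, fun z hz => ?_⟩
    exact hsub z u (hu z (e ▸ hz)) hw
  rcases isEmpty_or_nonempty V with hV | hV
  · exact ⟨id, fun _ => rfl, fun W hW _ => (hV.false hW.some).elim⟩
  have hch : ∀ T : Set V, ∃ b : V, T.Nonempty → b ∈ T := by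
    intro T
    by_cases hT : T.Nonempty
    · exact ⟨hT.some, fun _ => hT.some_mem⟩
    · exact ⟨hV.some, fun h => (hT h).elim⟩
  choose a ha using hch
  have haS : ∀ u, a (S u) ∈ S u := fun u => ha _ ⟨u, hself u⟩
  have hfaS : ∀ u, f (a (S u)) ∈ S u := fun u => hsub u _ (haS u) (hfS _)
  let γ : V → V := fun u => if R u then Equiv.swap (a (S u)) (f (a (S u))) u else u
  refine ⟨γ, ?_, ?_⟩
  · intro u
    by_cases hu : R u
    · have h1 : γ u = Equiv.swap (a (S u)) (f (a (S u))) u := if_pos hu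
      have h2 : γ u ∈ S u := by
        rw [h1, Equiv.swap_apply_def]
        split_ifs
        · exact hfaS u
        · exact haS u
        · exact hself u
      obtain ⟨h3, h4⟩ := hR u _ hu h2
      have h5 : γ (γ u) = Equiv.swap (a (S (γ u))) (f (a (S (γ u)))) (γ u) := if_pos h4
      rw [h5, h3, h1, Equiv.swap_apply_self]
    · have h1 : γ u = u := if_neg hu
      rw [h1, h1]
  · intro W hW hWf
    have hWS : ∀ u ∈ W, S u ⊆ W := by
      rintro u hu _ ⟨n, rfl⟩
      induction n with
      | zero => exact hu
      | succ n ih => rw [Function.iterate_succ_apply']; exact hWf _ ih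
    obtain ⟨u, hu, hmin⟩ := Set.exists_min_image W (fun u => (S u).ncard) (Set.toFinite W) hW
    have hRu : R u := by
      intro w hw
      have := Set.eq_of_subset_of_ncard_le (hsub u w hw) (hmin w (hWS u hu hw)) (Set.toFinite _)
      rw [this]; exact hself u
    obtain ⟨h3, h4⟩ := hR u _ hRu (haS u)
    refine ⟨a (S u), hWS u hu (haS u), ?_⟩
    have h5 : γ (a (S u)) = Equiv.swap (a (S (a (S u)))) (f (a (S (a (S u))))) (a (S u)) :=
      if_pos h4
    rw [h5, h3, Equiv.swap_apply_left]

/-- A vertex on a cycle has two distinct neighbours along the cycle. -/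
lemma cycle_two_nbrs {V : Type*} {G : SimpleGraph V} {u : V} (c : G.Walk u u) (hc : c.IsCycle)
    {v : V} (hv : v ∈ c.support) :
    ∃ y z, y ≠ z ∧ s(v, y) ∈ c.edges ∧ s(v, z) ∈ c.edges := by
  classical
  have hr := hc.rotate hv
  have he : ∀ e, e ∈ (c.rotate v hv).edges → e ∈ c.edges := fun e h =>
    (c.rotate_edges v hv).perm.mem_iff.1 h
  refine ⟨(c.rotate v hv).snd, (c.rotate v hv).penultimate, hr.snd_ne_penultimate, ?_, ?_⟩
  · exact he _ (Walk.mk_start_snd_mem_edges hr.not_nil)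
  · rw [Sym2.eq_swap]
    exact he _ (Walk.mk_penultimate_end_mem_edges hr.not_nil)

/-- The graph of edges of `G` not selected by `f`. -/
def rest {V : Type*} (G : SimpleGraph V) (f : V → V) : SimpleGraph V where
  Adj u v := G.Adj u v ∧ f u ≠ v ∧ f v ≠ u
  symm := ⟨fun _ _ h => ⟨h.1.symm, h.2.2, h.2.1⟩⟩
  loopless := ⟨fun _ h => G.loopless.irrefl _ h.1⟩

/-- `f` selects injectively an incident edge at each vertex. -/
def Sel {V : Type*} (G : SimpleGraph V) (f : V → V) : Prop :=
  (∀ u, G.Adj u (f u)) ∧ ∀ u, f (f u) ≠ u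

lemma exists_sel {V : Type*} [Fintype V] (G : SimpleGraph V)
    [DecidableRel G.Adj] (hcubic : G.IsRegularOfDegree 3) : ∃ f, Sel G f := by
  classical
  have hall : ∃ F : V → Sym2 V, Function.Injective F ∧ ∀ u, F u ∈ G.incidenceFinset u := by
    rw [← Finset.all_card_le_biUnion_card_iff_exists_injective]
    intro s
    have := Finset.card_mul_le_card_mul (s := s) (t := s.biUnion fun u => G.incidenceFinset u)
      (m := 3) (n := 2) (fun u e => u ∈ e) ?_ ?_
    · omega
    · intro u hu
      rw [← hcubic u, ← G.card_incidenceFinset_eq_degree u]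
      apply Finset.card_le_card
      intro e he
      rw [Finset.mem_bipartiteAbove]
      refine ⟨Finset.mem_biUnion.2 ⟨u, hu, he⟩, ?_⟩
      rw [mem_incidenceFinset] at he
      exact he.2
    · intro e he
      calc _ ≤ e.toFinset.card := by
            apply Finset.card_le_card
            intro u hu
            rw [Finset.mem_bipartiteBelow] at hu
            exact Sym2.mem_toFinset.2 hu.2
        _ ≤ 2 := by
            rw [Sym2.card_toFinset]
            split_ifs <;> omega
  obtain ⟨F, hF, hmem⟩ := hall
  have : ∀ u, ∃ v, F u = s(u, v) ∧ G.Adj u v := by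
    intro u
    have h := hmem u
    rw [mem_incidenceFinset] at h
    obtain ⟨v, hv⟩ := h.2
    refine ⟨v, hv, ?_⟩
    have h1 := h.1
    rwa [hv, mem_edgeSet] at h1
  choose f hf1 hf2 using this
  refine ⟨f, hf2, fun u h => ?_⟩
  have h1 : F u = F (f u) := by rw [hf1 u, hf1 (f u), h, Sym2.eq_swap]
  have := hF h1
  exact (hf2 u).ne this

/-- In a cubic graph, two other neighbours different from `f v` exhaust the neighbourhood. -/
lemma nbr_cases {V : Type*} [Fintype V] (G : SimpleGraph V)
    [DecidableRel G.Adj] (hcubic : G.IsRegularOfDegree 3) {v x y z : V} (hx : G.Adj v x)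
    (hy : G.Adj v y) (hz : G.Adj v z) (hxy : x ≠ y) (hxz : x ≠ z) (hyz : y ≠ z) {b : V}
    (hb : G.Adj v b) : b = x ∨ b = y ∨ b = z := by
  classical
  have hsub : ({x, y, z} : Finset V) ⊆ G.neighborFinset v := by
    intro t ht
    simp only [Finset.mem_insert, Finset.mem_singleton] at ht
    rw [mem_neighborFinset]
    rcases ht with rfl | rfl | rfl <;> assumption
  have heq := Finset.eq_of_subset_of_card_le hsub (by
    rw [Finset.card_eq_three.2 ⟨x, y, z, hxy, hxz, hyz, rfl⟩]
    exact (hcubic v).le)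
  have : b ∈ ({x, y, z} : Finset V) := by rw [heq, mem_neighborFinset]; exact hb
  simpa using this

lemma exists_sel_acyclic {V : Type*} [Fintype V] (G : SimpleGraph V)
    [DecidableRel G.Adj] (hcubic : G.IsRegularOfDegree 3) :
    ∃ f, Sel G f ∧ (rest G f).IsAcyclic := by
  classical
  let P : (V → V) → Set (V × V) := fun f => {p | (rest G f).Reachable p.1 p.2}
  obtain ⟨f, hf, hmax⟩ := Set.exists_max_image {f | Sel G f} (fun f => (P f).ncard)
    (Set.toFinite _) (exists_sel G hcubic)
  refine ⟨f, hf, ?_⟩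
  intro u c hc
  obtain ⟨hf1, hf2⟩ := hf
  -- the edges of the cycle
  have hadj : ∀ a b, s(a, b) ∈ c.edges → (rest G f).Adj a b := fun a b h =>
    Walk.adj_of_mem_edges c h
  -- neighbours of support
  have hnb : ∀ v ∈ c.support, ∀ b, G.Adj v b → b = f v ∨ s(v, b) ∈ c.edges := by
    intro v hv b hb
    obtain ⟨y, z, hyz, hy, hz⟩ := cycle_two_nbrs c hc hv
    have h1 := hadj _ _ hy
    have h2 := hadj _ _ hz
    rcases nbr_cases G hcubic (hf1 v) h1.1 h2.1 h1.2.1 h2.2.1 hyz hb with h | h | h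
    · exact Or.inl h
    · subst h; exact Or.inr hy
    · subst h; exact Or.inr hz
  have hclosed : ∀ v ∈ c.support, ∀ b, (rest G f).Adj v b → b ∈ c.support := by
    intro v hv b hb
    rcases hnb v hv b hb.1 with h | h
    · exact (hb.2.1 h.symm).elim
    · exact c.snd_mem_support_of_mem_edges h
  have hx : f u ∉ c.support := by
    intro hx
    rcases hnb _ hx u (hf1 u).symm with h | h
    · exact hf2 u h.symm
    · exact (hadj _ _ h).2.2 rfl
  have hnr : ¬ (rest G f).Reachable u (f u) := by
    rintro ⟨p⟩
    have : ∀ (a b : V) (p : (rest G f).Walk a b), a ∈ c.support → b ∈ c.support := by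
      intro a b p
      induction p with
      | nil => exact id
      | cons h p ih => exact fun ha => ih (hclosed _ ha _ h)
    exact hx (this _ _ p c.start_mem_support)
  set w := c.snd with hw
  have hwe : s(u, w) ∈ c.edges := Walk.mk_start_snd_mem_edges hc.not_nil
  have huw := hadj _ _ hwe
  let f' := Function.update f u w
  have hfu : f' u = w := Function.update_self ..
  have hfo : ∀ v, v ≠ u → f' v = f v := fun v hv => Function.update_of_ne hv ..
  have hsel' : Sel G f' := by
    refine ⟨fun v => ?_, fun v => ?_⟩
    · by_cases hv : v = u
      · subst hv; rw [hfu]; exact huw.1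
      · rw [hfo v hv]; exact hf1 v
    · by_cases hv : v = u
      · subst hv; rw [hfu, hfo _ huw.1.ne.symm]; exact huw.2.2
      · rw [hfo v hv]
        by_cases hv' : f v = u
        · rw [hv', hfu]; rintro rfl; exact huw.2.2 hv'
        · rw [hfo _ hv']; exact hf2 v
  have hle : (rest G f).deleteEdges {s(u, w)} ≤ rest G f' := by
    intro a b hab
    rw [deleteEdges_adj] at hab
    obtain ⟨⟨h1, h2, h3⟩, h4⟩ := hab
    refine ⟨h1, ?_, ?_⟩
    · by_cases ha : a = u
      · subst ha; rw [hfu]; rintro rfl; exact h4 rfl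
      · rwa [hfo a ha]
    · by_cases hb : b = u
      · subst hb; rw [hfu]; rintro rfl; exact h4 Sym2.eq_swap
      · rwa [hfo b hb]
  have hnbr : ((rest G f).deleteEdges {s(u, w)}).Reachable u w := by
    by_contra hcon
    have : (rest G f).IsBridge s(u, w) := by
      rw [isBridge_iff]
      first
        | exact ⟨huw, hcon⟩
        | exact hcon
    rw [isBridge_iff_forall_cycle_notMem] at this
    · exact this c hc hwe
    · exact huw
  have hstep : ∀ a b, (rest G f).Adj a b → (rest G f').Reachable a b := by
    intro a b hab
    by_cases h : s(a, b) = s(u, w)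
    · rw [Sym2.eq_iff] at h
      rcases h with ⟨rfl, rfl⟩ | ⟨rfl, rfl⟩
      · exact hnbr.mono hle
      · exact (hnbr.mono hle).symm
    · exact (hle (by rw [deleteEdges_adj]; exact ⟨hab, h⟩)).reachable
  have hreach : ∀ a b, (rest G f).Reachable a b → (rest G f').Reachable a b := by
    rintro a b ⟨p⟩
    induction p with
    | nil => exact Reachable.refl _
    | cons h p ih => exact (hstep _ _ h).trans ih
  have hux : (rest G f').Adj u (f u) := by
    refine ⟨hf1 u, ?_, ?_⟩
    · rw [hfu]; exact fun h => huw.2.1 h.symm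
    · rw [hfo _ (hf1 u).ne.symm]; exact hf2 u
  have hss : P f ⊂ P f' := by
    refine ⟨fun p hp => hreach _ _ hp, fun h => ?_⟩
    exact hnr (h (show (u, f u) ∈ P f' from hux.reachable))
  have h1 := Set.ncard_lt_ncard hss (Set.toFinite _)
  exact absurd (hmax f' hsel') (not_le.2 h1)

/-- The coloring, as a function of ordered pairs. -/
lemma exists_col {V : Type*} [Fintype V] (G : SimpleGraph V)
    [DecidableRel G.Adj] (hcubic : G.IsRegularOfDegree 3) :
    ∃ col : V → V → ℕ,
      (∀ u v, col u v ∈ ({1, 2, 3} : Set ℕ)) ∧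
      (∀ u v w, G.Adj u v → G.Adj u w → v ≠ w → col u v ≠ col u w) ∧
      (∀ u v, G.Adj u v → col u v ≠ col v u) ∧
      ∀ (u : V) (c : G.Walk u u), c.IsCycle →
        ¬ ∃ a b : ℕ, ∀ d ∈ c.darts,
            col d.fst d.snd ∈ ({a, b} : Set ℕ) ∧ col d.snd d.fst ∈ ({a, b} : Set ℕ) := by
  classical
  obtain ⟨f, ⟨hf1, hf2⟩, hacyc⟩ := exists_sel_acyclic G hcubic
  obtain ⟨γ, hγ, hγW⟩ := exists_gamma f
  -- the other two neighbours
  have hpq : ∀ u, ∃ p q, p ≠ q ∧ p ≠ f u ∧ q ≠ f u ∧ ∀ v, G.Adj u v → v ≠ f u → v = p ∨ v = q := by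
    intro u
    have h1 : ((G.neighborFinset u).erase (f u)).card = 2 := by
      rw [Finset.card_erase_of_mem (by rw [mem_neighborFinset]; exact hf1 u)]
      have : (G.neighborFinset u).card = 3 := hcubic u
      omega
    obtain ⟨p, q, hpq, he⟩ := Finset.card_eq_two.1 h1
    have hm : ∀ v, (v ≠ f u ∧ G.Adj u v) ↔ (v = p ∨ v = q) := by
      intro v
      have : v ∈ (G.neighborFinset u).erase (f u) ↔ v ∈ ({p, q} : Finset V) := by rw [he]
      simpa using this
    exact ⟨p, q, hpq, ((hm p).2 (Or.inl rfl)).1, ((hm q).2 (Or.inr rfl)).1,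
      fun v h1 h2 => (hm v).1 ⟨h2, h1⟩⟩
  choose p q hpq hpf hqf hpqc using hpq
  let α : V × V → V × V := fun x => (x.1, Equiv.swap (p x.1) (q x.1) x.2)
  have hα : Function.Involutive α := by
    rintro ⟨u, v⟩
    simp [α]
  let β : V × V → V × V := fun x =>
    if f x.2 = x.1 then (f (γ x.2), γ x.2) else if f x.1 = x.2 then x else (x.2, x.1)
  have hβ : Function.Involutive β := by
    rintro ⟨v, u⟩
    by_cases h1 : f u = v
    · simp [β, h1, hγ u]
    · by_cases h2 : f v = u
      · simp [β, h1, h2]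
      · simp [β, h1, h2]
  obtain ⟨x, hx⟩ := two_matchings α β hα hβ
  let col : V → V → ℕ := fun u v => if v = f u then 3 else if x (u, v) then 1 else 2
  have hc3 : ∀ u v, col u v = 3 ↔ v = f u := by
    intro u v
    simp only [col]
    split_ifs <;> simp_all
  have hcn : ∀ u v u' v', v ≠ f u → v' ≠ f u' → x (u, v) ≠ x (u', v') → col u v ≠ col u' v' := by
    intro u v u' v' h1 h2 h3
    simp only [col, h1, h2, if_false]
    cases h4 : x (u, v) <;> cases h5 : x (u', v') <;> simp_all
  have hprop : ∀ u v w, G.Adj u v → G.Adj u w → v ≠ w → col u v ≠ col u w := by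
    intro u v w hv hw hvw
    by_cases h1 : v = f u
    · intro h
      have := (hc3 u w).1 (h ▸ (hc3 u v).2 h1)
      exact hvw (h1.trans this.symm)
    by_cases h2 : w = f u
    · intro h
      have := (hc3 u v).1 (h ▸ (hc3 u w).2 h2)
      exact h1 this
    apply hcn _ _ _ _ h1 h2
    have h3 := (hx (u, v)).1
    have h4 : α (u, v) = (u, w) := by
      rcases hpqc u v hv h1 with h | h <;> rcases hpqc u w hw h2 with h' | h'
      · exact (hvw (h.trans h'.symm)).elim
      · simp [α, h, h']
      · simp [α, h, h']
      · exact (hvw (h.trans h'.symm)).elim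
    rw [h4] at h3
    exact (h3 (fun h => hvw (Prod.ext_iff.1 h).2.symm)).symm
  have hopp : ∀ u v, G.Adj u v → col u v ≠ col v u := by
    intro u v huv
    by_cases h1 : v = f u
    · intro h
      have := (hc3 v u).1 (h ▸ (hc3 u v).2 h1)
      rw [h1] at this
      exact hf2 u this.symm
    by_cases h2 : u = f v
    · intro h
      exact h1 ((hc3 u v).1 (h ▸ (hc3 v u).2 h2))
    apply hcn _ _ _ _ h1 h2
    have h3 := (hx (u, v)).2
    have h4 : β (u, v) = (v, u) := by
      simp [β, Ne.symm h1, Ne.symm h2]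
    rw [h4] at h3
    exact (h3 (fun h => huv.ne (Prod.ext_iff.1 h).2)).symm
  refine ⟨col, ?_, hprop, hopp, ?_⟩
  · intro u v
    simp only [col]
    split_ifs <;> simp
  rintro u c hc ⟨a, b, hab⟩
  -- transfer to edges
  have hE : ∀ y z, s(y, z) ∈ c.edges →
      G.Adj y z ∧ col y z ∈ ({a, b} : Set ℕ) ∧ col z y ∈ ({a, b} : Set ℕ) := by
    intro y z hyz
    refine ⟨Walk.adj_of_mem_edges c hyz, ?_⟩
    obtain ⟨d, hd, hde⟩ := List.mem_map.1 hyz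
    have := hab d hd
    have hde' : s(d.fst, d.snd) = s(y, z) := hde
    rw [Sym2.eq_iff] at hde'
    rcases hde' with ⟨rfl, rfl⟩ | ⟨rfl, rfl⟩
    · exact this
    · exact this.symm
  have key : ∀ t : ℕ, ({a, b} : Set ℕ) = {t, 3} → False := by
    intro t ht
    rw [ht] at hE
    have hW : ∀ v ∈ c.support, f v ∈ c.support ∧ col (f v) v = t := by
      intro v hv
      obtain ⟨y, z, hyz, hy, hz⟩ := cycle_two_nbrs c hc hv
      have hy' := hE _ _ hy
      have hz' := hE _ _ hz
      have hne := hprop v y z hy'.1 hz'.1 hyz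
      have hfe : s(v, f v) ∈ c.edges := by
        rcases hy'.2.1 with h1 | h1
        · rcases hz'.2.1 with h2 | h2
          · exact (hne (h1.trans h2.symm)).elim
          · rw [← (hc3 v z).1 h2]; exact hz
        · rw [← (hc3 v y).1 h1]; exact hy
      refine ⟨c.snd_mem_support_of_mem_edges hfe, ?_⟩
      rcases (hE _ _ hfe).2.2 with h | h
      · exact h
      · exact (hf2 v ((hc3 (f v) v).1 h).symm).elim
    obtain ⟨r, hr, hγr⟩ := hγW {v | v ∈ c.support} ⟨u, c.start_mem_support⟩
      (fun v hv => (hW v hv).1)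
    have h1 := (hW r hr).2
    have h2 := (hW (f r) (hW r hr).1).2
    have h3 := (hx (f r, r)).2
    have h4 : β (f r, r) = (f (f r), f r) := by simp [β, hγr]
    rw [h4] at h3
    have h5 := h3 (fun h => (hf1 r).ne (Prod.ext_iff.1 h).2.symm)
    exact hcn _ _ _ _ (fun h => hf2 (f r) h.symm) (fun h => hf2 r h.symm) h5 (h2.trans h1.symm)
  by_cases ha : a = 3
  · exact key b (by rw [ha, Set.pair_comm])
  by_cases hb : b = 3
  · exact key a (by rw [hb])
  have hM : ∀ e ∈ c.edges, e ∈ (rest G f).edgeSet := by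
    intro e
    induction e using Sym2.inductionOn with
    | hf y z =>
      intro he
      obtain ⟨h1, h2, h3⟩ := hE _ _ he
      have h4 : ∀ n ∈ ({a, b} : Set ℕ), n ≠ 3 := by
        rintro n (rfl | rfl) <;> assumption
      exact ⟨h1, fun h => h4 _ h2 ((hc3 _ _).2 h.symm), fun h => h4 _ h3 ((hc3 _ _).2 h.symm)⟩
  exact hacyc (c.transfer _ hM) (hc.transfer hM)

/-- Invariant of subdivision vertices. -/
def phi {V : Type*} (G : SimpleGraph V) : SubdivVert G 2 → Sym2 V :=
  Quot.lift (fun p => if p.1.2.2 = 0 then s(p.1.1, p.1.1) else if p.1.2.2 = 1 then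
    s(p.1.1, p.1.2.1) else s(p.1.2.1, p.1.2.1)) (by
    rintro _ _ (⟨u, v, i, h, hi⟩ | ⟨u, v, h⟩)
    · interval_cases i
      · simp
      · simp [Sym2.eq_swap]
      · simp
    · simp)

lemma phi_branch {V : Type*} (G : SimpleGraph V) (u : V) :
    phi G (branchVertex G 2 u) = s(u, u) := by
  simp [phi, branchVertex]

lemma phi_mid {V : Type*} (G : SimpleGraph V) {u v : V} (h : G.Adj u v) (hi : 1 ≤ 2) :
    phi G (mkVert G 2 h 1 hi) = s(u, v) := by
  simp [phi, mkVert]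

lemma edge_is_half {V : Type*} (G : SimpleGraph V) (e : Sym2 (SubdivVert G 2))
    (he : e ∈ (subdivision G 2).edgeSet) : ∃ u v, ∃ h : G.Adj u v, e = halfEdge G h := by
  have main : ∀ x y : SubdivVert G 2, (∃ (u v : V) (h : G.Adj u v) (i : ℕ) (hi : i < 2),
      x = mkVert G 2 h i (le_of_lt hi) ∧ y = mkVert G 2 h (i + 1) hi) →
      ∃ u v, ∃ h : G.Adj u v, s(x, y) = halfEdge G h := by
    rintro x y ⟨u, v, h, i, hi, rfl, rfl⟩
    interval_cases i
    · refine ⟨u, v, h, ?_⟩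
      have h1 : mkVert G 2 h 0 (le_of_lt hi) = branchVertex G 2 u :=
        Quot.sound (SubdivRel.collapse u v h)
      rw [h1]; rfl
    · refine ⟨v, u, h.symm, ?_⟩
      have h1 : mkVert G 2 h.symm 0 (by omega) = branchVertex G 2 v :=
        Quot.sound (SubdivRel.collapse v u h.symm)
      have h2 : mkVert G 2 h 2 (by omega) = mkVert G 2 h.symm 0 (by omega) :=
        Quot.sound (SubdivRel.flip u v 2 h (by omega))
      have h3 : mkVert G 2 h 1 (by omega) = mkVert G 2 h.symm 1 (by omega) :=
        Quot.sound (SubdivRel.flip u v 1 h (by omega))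
      unfold halfEdge
      rw [← h1, ← h2, ← h3, Sym2.eq_swap]
  induction e using Sym2.inductionOn with
  | hf x y =>
    rw [mem_edgeSet, subdivision, fromRel_adj] at he
    rcases he.2 with h | h
    · exact main x y h
    · rw [Sym2.eq_swap]; exact main y x h

lemma half_inj {V : Type*} (G : SimpleGraph V) {u v u' v' : V} (h : G.Adj u v)
    (h' : G.Adj u' v') (e : halfEdge G h = halfEdge G h') : u = u' ∧ v = v' := by
  have e' := congrArg (Sym2.map (phi G)) e
  simp only [halfEdge, Sym2.map_mk, phi_branch, phi_mid] at e'
  have n1 := h.ne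
  have n2 := h'.ne
  simp only [Sym2.eq_iff] at e'
  grind

end GoodHalfEdge

theorem exists_good_halfEdge_coloring {V : Type*} [Fintype V] (G : SimpleGraph V)
    [DecidableRel G.Adj] (hcubic : G.IsRegularOfDegree 3) :
    ∃ h : Sym2 (SubdivVert G 2) → ℕ,
      (∀ e ∈ (subdivision G 2).edgeSet, h e ∈ ({1, 2, 3} : Set ℕ)) ∧
      IsProperEdgeColoring (subdivision G 2) h ∧
      ∀ (u : V) (c : G.Walk u u), c.IsCycle →
        ¬ ∃ a b : ℕ, ∀ d ∈ c.darts,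
            h (halfEdge G d.adj) ∈ ({a, b} : Set ℕ) ∧
            h (halfEdge G d.adj.symm) ∈ ({a, b} : Set ℕ) := by
  classical
  obtain ⟨col, hc1, hc2, hc3, hc4⟩ := GoodHalfEdge.exists_col G hcubic
  have hex : ∃ h : Sym2 (SubdivVert G 2) → ℕ, ∀ u v (a : G.Adj u v),
      h (halfEdge G a) = col u v := by
    have : ∀ e : Sym2 (SubdivVert G 2), ∃ n : ℕ, ∀ u v (a : G.Adj u v),
        e = halfEdge G a → n = col u v := by
      intro e
      by_cases he : ∃ u v, ∃ a : G.Adj u v, e = halfEdge G a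
      · obtain ⟨u, v, a, rfl⟩ := he
        refine ⟨col u v, fun u' v' a' e => ?_⟩
        obtain ⟨rfl, rfl⟩ := GoodHalfEdge.half_inj G a a' e
        rfl
      · exact ⟨0, fun u v a e => (he ⟨u, v, a, e⟩).elim⟩
    choose h hh using this
    exact ⟨h, fun u v a => hh _ u v a rfl⟩
  obtain ⟨h, hh⟩ := hex
  refine ⟨h, ?_, ?_, ?_⟩
  · intro e he
    obtain ⟨u, v, a, rfl⟩ := GoodHalfEdge.edge_is_half G e he
    rw [hh]; exact hc1 u v
  · rintro e₁ he₁ e₂ he₂ hne ⟨x, hx1, hx2⟩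
    obtain ⟨u, v, a, rfl⟩ := GoodHalfEdge.edge_is_half G e₁ he₁
    obtain ⟨u', v', a', rfl⟩ := GoodHalfEdge.edge_is_half G e₂ he₂
    rw [hh, hh]
    have k1 : GoodHalfEdge.phi G x = s(u, u) ∨ GoodHalfEdge.phi G x = s(u, v) := by
      rcases Sym2.mem_iff.1 hx1 with rfl | rfl
      · exact Or.inl (GoodHalfEdge.phi_branch G u)
      · exact Or.inr (GoodHalfEdge.phi_mid G a _)
    have k2 : GoodHalfEdge.phi G x = s(u', u') ∨ GoodHalfEdge.phi G x = s(u', v') := by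
      rcases Sym2.mem_iff.1 hx2 with rfl | rfl
      · exact Or.inl (GoodHalfEdge.phi_branch G u')
      · exact Or.inr (GoodHalfEdge.phi_mid G a' _)
    have hcase : u = u' ∨ (u = v' ∧ v = u') := by
      have n1 := a.ne
      have n2 := a'.ne
      rcases k1 with k1 | k1 <;> rcases k2 with k2 | k2 <;>
        · rw [k1, Sym2.eq_iff] at k2
          grind
    rcases hcase with rfl | ⟨rfl, rfl⟩
    · apply hc2 _ _ _ a a'
      rintro rfl
      exact hne rfl
    · exact hc3 _ _ a
  · rintro u c hc ⟨a, b, hab⟩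
    refine hc4 u c hc ⟨a, b, fun d hd => ?_⟩
    have := hab d hd
    rw [hh, hh] at this
    exact this
end

section
/- Let G be a finite cubic (3-regular) simple graph and let h be a good half-edge coloring of G with colors {1,2,3}. Then there exists an orientation of the edges of G^{1/2} such that for every edge uv of G, whenever u' ∈ N_G(u)\{v} and v' ∈ N_G(v)\{u} satisfy h(e_{uu'}) = h(e_{vv'}), exactly one of the half-edges e_{uu'}, e_{vv'} is oriented inwards (towards its branch vertex) and the other is oriented outwards. -/
open SimpleGraph

/-- The edge whose midpoint is the given point of `G^{1/2}`, if any. -/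
def midEdge {V : Type*} (G : SimpleGraph V) : SubdivVert G 2 → Option (Sym2 V) :=
  Quot.lift (fun p => if p.1.2.2 = 1 then some s(p.1.1, p.1.2.1) else none) (by
    intro a b hab
    cases hab with
    | flip u v i h hi =>
      by_cases h1 : i = 1
      · subst h1
        simp [Sym2.eq_swap]
      · have h2 : ¬ (2 - i = 1) := by omega
        simp [h1, h2]
    | collapse u v h => simp)

theorem midEdge_mkVert {V : Type*} (G : SimpleGraph V) {u v : V} (h : G.Adj u v) :
    midEdge G (mkVert G 2 h 1 (by omega)) = some s(u, v) := by
  simp [midEdge, mkVert]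

theorem midEdge_branch {V : Type*} (G : SimpleGraph V) (u : V) :
    midEdge G (branchVertex G 2 u) = none := by
  simp [midEdge, branchVertex]

theorem branch_ne {V : Type*} (G : SimpleGraph V) (w : V) {u v : V} (h : G.Adj u v) :
    branchVertex G 2 w ≠ mkVert G 2 h 1 (by omega) := by
  intro he
  have := congrArg (midEdge G) he
  simp [midEdge_mkVert, midEdge_branch] at this

theorem halfEdge_mem {V : Type*} (G : SimpleGraph V) {u v : V} (h : G.Adj u v) :
    halfEdge G h ∈ (subdivision G 2).edgeSet := by
  unfold halfEdge subdivision
  rw [SimpleGraph.mem_edgeSet, SimpleGraph.fromRel_adj]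
  refine ⟨branch_ne G u h, Or.inl ⟨u, v, h, 0, by omega, ?_, rfl⟩⟩
  exact (Quot.sound (SubdivRel.collapse u v h)).symm

theorem halfEdge_ne {V : Type*} (G : SimpleGraph V) {u v w : V} (h : G.Adj u v)
    (h' : G.Adj u w) (hne : v ≠ w) : halfEdge G h ≠ halfEdge G h' := by
  intro he
  unfold halfEdge at he
  rw [Sym2.congr_right] at he
  have := congrArg (midEdge G) he
  rw [midEdge_mkVert, midEdge_mkVert, Option.some_inj, Sym2.congr_right] at this
  exact hne this

/-- The subgraph of edges of `G` with neither half-edge coloured `c`. -/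
def avoidGraph {V : Type*} (G : SimpleGraph V) (h : Sym2 (SubdivVert G 2) → ℕ) (c : ℕ) :
    SimpleGraph V where
  Adj u v := ∃ huv : G.Adj u v, h (halfEdge G huv) ≠ c ∧ h (halfEdge G huv.symm) ≠ c
  symm := ⟨fun _ _ ⟨huv, h1, h2⟩ => ⟨huv.symm, h2, h1⟩⟩
  loopless := ⟨fun _ ⟨huv, _⟩ => G.loopless.irrefl _ huv⟩

theorem avoidGraph_le {V : Type*} (G : SimpleGraph V) (h : Sym2 (SubdivVert G 2) → ℕ) (c : ℕ) :
    avoidGraph G h c ≤ G := fun _ _ hh => hh.1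

/-- For an orientation `o`, `o huv = true` means the half-edge `e_{uv}` is oriented
inwards (towards the branch vertex `u`), and `o huv = false` means it is oriented
outwards; this encodes an orientation of `G^{1/2}` since the edges of `G^{1/2}` are
exactly the half-edges `e_{uv}`, one for each ordered adjacent pair `(u, v)`. -/
theorem exists_orientation_of_good_halfEdge_coloring {V : Type*} [Fintype V]
    (G : SimpleGraph V) [DecidableRel G.Adj] (hcubic : G.IsRegularOfDegree 3)
    (h : Sym2 (SubdivVert G 2) → ℕ)
    (hcolors : ∀ e ∈ (subdivision G 2).edgeSet, h e ∈ ({1, 2, 3} : Set ℕ))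
    (hproper : IsProperEdgeColoring (subdivision G 2) h)
    (hgood : ∀ (u : V) (c : G.Walk u u), c.IsCycle →
      ¬ ∃ a b : ℕ, ∀ d ∈ c.darts,
          h (halfEdge G d.adj) ∈ ({a, b} : Set ℕ) ∧
          h (halfEdge G d.adj.symm) ∈ ({a, b} : Set ℕ)) :
    ∃ o : ∀ ⦃u v : V⦄, G.Adj u v → Bool,
      ∀ (u v u' v' : V) (huv : G.Adj u v) (hu : G.Adj u u') (hv : G.Adj v v'),
        u' ≠ v → v' ≠ u → h (halfEdge G hu) = h (halfEdge G hv) → o hu ≠ o hv := by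
  classical
  have hne : ∀ {u v w : V} (h1 : G.Adj u v) (h2 : G.Adj u w), v ≠ w →
      h (halfEdge G h1) ≠ h (halfEdge G h2) := fun {u v w} h1 h2 hn =>
    hproper _ (halfEdge_mem G h1) _ (halfEdge_mem G h2) (halfEdge_ne G h1 h2 hn)
      ⟨branchVertex G 2 u, Sym2.mem_mk_left _ _, Sym2.mem_mk_left _ _⟩
  have hac : ∀ c ∈ ({1, 2, 3} : Set ℕ), (avoidGraph G h c).IsAcyclic := by
    intro c hc u p hp
    obtain ⟨a, b, hab⟩ : ∃ a b : ℕ, ∀ x ∈ ({1, 2, 3} : Set ℕ), x ≠ c → x ∈ ({a, b} : Set ℕ) := by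
      simp only [Set.mem_insert_iff, Set.mem_singleton_iff] at hc ⊢
      rcases hc with rfl | rfl | rfl
      · exact ⟨2, 3, by omega⟩
      · exact ⟨1, 3, by omega⟩
      · exact ⟨1, 2, by omega⟩
    refine hgood u (p.mapLe (avoidGraph_le G h c)) (hp.mapLe _) ⟨a, b, ?_⟩
    intro d hd
    have hd' : (avoidGraph G h c).Adj d.fst d.snd := by
      rw [SimpleGraph.Walk.mapLe, SimpleGraph.Walk.darts_map, List.mem_map] at hd
      obtain ⟨e, _, rfl⟩ := hd
      exact e.adj
    obtain ⟨_, h1, h2⟩ := hd'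
    exact ⟨hab _ (hcolors _ (halfEdge_mem G d.adj)) h1,
      hab _ (hcolors _ (halfEdge_mem G d.adj.symm)) h2⟩
  have hcol : ∀ c : ℕ, ∃ f : V → Bool, c ∈ ({1, 2, 3} : Set ℕ) →
      ∀ u v, (avoidGraph G h c).Adj u v → f u ≠ f v := by
    intro c
    by_cases hc : c ∈ ({1, 2, 3} : Set ℕ)
    · obtain ⟨C⟩ := SimpleGraph.IsAcyclic.colorable_two (hac c hc)
      exact ⟨fun u => decide (C u = 0), fun _ u v huv => by
        have := C.valid huv
        grind⟩
    · exact ⟨fun _ => true, fun hh => absurd hh hc⟩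
  choose f hf using hcol
  refine ⟨fun u v huv => f (h (halfEdge G huv)) u, ?_⟩
  intro u v u' v' huv hu hv hu' hv' heq
  show f (h (halfEdge G hu)) u ≠ f (h (halfEdge G hv)) v
  rw [← heq]
  refine hf _ (hcolors _ (halfEdge_mem G hu)) u v ⟨huv, hne huv hu hu'.symm, ?_⟩
  rw [heq]
  exact hne huv.symm hv hv'.symm
end
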